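/- arXiv:2107.09438 — 3 statements merged into one kernel-verified Lean document; each statement's English description precedes it below -/
import Mathlib

section
/- There exist absolute constants ν₀ > 0, c₀ > 0 and γ₁ > 0 such that for every 0 < ν < ν₀ and every integer N with 1/(2√3 π ν) ≤ N ≤ c₀ ν^{−1/2} e^{1/(6ν)}: the set of x ∈ 𝕋 with K_N(x) < −0.3/(1 + 4π²ν²(N+1)²) has Lebesgue measure at least γ₁, and ‖K_N‖_{L¹(𝕋)} ≥ 1 + γ₁/(1 + 4π²ν²(N+1)²). -/
open MeasureTheory

noncomputable section

/-- The character `e^{2πit}`. -/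
def e1 (t : ℝ) : ℂ := Complex.exp (2 * Real.pi * Complex.I * t)

/-- The truncated kernel `K_N(x) = ∑_{|k| ≤ N} (1 + 4π²ν²k²)⁻¹ e^{2πikx}` on `𝕋`. -/
def KNker (ν : ℝ) (N : ℕ) (x : ℝ) : ℂ :=
  ∑ k ∈ Finset.Icc (-(N : ℤ)) (N : ℤ),
    (((1 + 4 * Real.pi ^ 2 * ν ^ 2 * (k : ℝ) ^ 2)⁻¹ : ℝ) : ℂ) * e1 ((k : ℝ) * x)

/-- The Fourier multiplier `(1 + 4π²ν²t²)⁻¹`. -/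
def resolventCoeff (ν t : ℝ) : ℝ := (1 + 4 * Real.pi ^ 2 * ν ^ 2 * t ^ 2)⁻¹

lemma resolventCoeff_pos (ν t : ℝ) : 0 < resolventCoeff ν t := by
  unfold resolventCoeff; positivity

lemma resolventCoeff_zero (ν : ℝ) : resolventCoeff ν 0 = 1 := by
  simp [resolventCoeff]

lemma tendsto_resolventCoeff {ν : ℝ} (hν : 0 < ν) :
    Filter.Tendsto (fun n : ℕ => resolventCoeff ν n) Filter.atTop (nhds 0) := by
  unfold resolventCoeff
  refine Filter.Tendsto.inv_tendsto_atTop (Filter.tendsto_atTop_add_const_left _ _ ?_)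
  refine Filter.Tendsto.const_mul_atTop (by positivity) ?_
  exact (Filter.tendsto_pow_atTop two_ne_zero).comp tendsto_natCast_atTop_atTop

/-- Convexity of the multiplier beyond its inflection point. -/
lemma resolventCoeff_midpoint_le {ν t : ℝ}
    (h : 1 + 4 * Real.pi ^ 2 * ν ^ 2 ≤ 3 * (4 * Real.pi ^ 2 * ν ^ 2) * t ^ 2) :
    2 * resolventCoeff ν t ≤ resolventCoeff ν (t - 1) + resolventCoeff ν (t + 1) := by
  unfold resolventCoeff
  have hb : 0 ≤ 4 * Real.pi ^ 2 * ν ^ 2 := by positivity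
  generalize 4 * Real.pi ^ 2 * ν ^ 2 = b at *
  have h1 : 0 < 1 + b * (t - 1) ^ 2 := by positivity
  have h2 : 0 < 1 + b * (t + 1) ^ 2 := by positivity
  have h3 : 0 < 1 + b * t ^ 2 := by positivity
  have key : (1 + b * (t - 1) ^ 2)⁻¹ + (1 + b * (t + 1) ^ 2)⁻¹ - 2 * (1 + b * t ^ 2)⁻¹ =
      2 * b * (3 * b * t ^ 2 - (1 + b)) /
        ((1 + b * (t - 1) ^ 2) * (1 + b * (t + 1) ^ 2) * (1 + b * t ^ 2)) := by
    field_simp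
    ring
  have : 0 ≤ 2 * b * (3 * b * t ^ 2 - (1 + b)) /
        ((1 + b * (t - 1) ^ 2) * (1 + b * (t + 1) ^ 2) * (1 + b * t ^ 2)) :=
    div_nonneg (mul_nonneg (by positivity) (by linarith)) (by positivity)
  linarith

lemma KNker_re_eq_sum_Icc (ν : ℝ) (N : ℕ) (x : ℝ) :
    (KNker ν N x).re = ∑ k ∈ Finset.Icc (-(N : ℤ)) (N : ℤ),
      resolventCoeff ν k * Real.cos (2 * Real.pi * k * x) := by
  simp only [KNker, e1, resolventCoeff, Complex.re_sum]
  refine Finset.sum_congr rfl fun k _ => ?_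
  rw [Complex.re_ofReal_mul, show (2 * Real.pi * Complex.I * ((k * x : ℝ) : ℂ)) =
    ((2 * Real.pi * k * x : ℝ) : ℂ) * Complex.I by push_cast; ring, Complex.exp_ofReal_mul_I_re]

lemma KNker_re_eq_sum_range (ν : ℝ) (N : ℕ) (x : ℝ) :
    (KNker ν N x).re = 2 * ∑ k ∈ Finset.range (N + 1),
      resolventCoeff ν k * Real.cos (2 * Real.pi * k * x) - 1 := by
  rw [KNker_re_eq_sum_Icc, Finset.sum_Icc_of_even_eq_range]
  · simp [resolventCoeff_zero]
  · intro k
    simp [resolventCoeff]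

lemma KNker_re_succ (ν : ℝ) (N : ℕ) (x : ℝ) :
    (KNker ν (N + 1) x).re = (KNker ν N x).re +
      2 * resolventCoeff ν (N + 1) * Real.cos (2 * Real.pi * (N + 1) * x) := by
  rw [KNker_re_eq_sum_range, KNker_re_eq_sum_range, Finset.sum_range_succ _ (N + 1)]
  push_cast
  ring

lemma continuous_KNker (ν : ℝ) (N : ℕ) : Continuous (KNker ν N) := by
  unfold KNker e1
  fun_prop

/-- The periodic resolvent kernel, whose Fourier coefficients are `(1 + 4π²ν²k²)⁻¹`. -/
def resolventKernel (ν x : ℝ) : ℝ :=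
  Real.cosh (ν⁻¹ * (1 / 2 - x)) / (2 * ν * Real.sinh (ν⁻¹ / 2))

lemma integral_fourier_mul_resolventKernel {ν : ℝ} (hν : 0 < ν) (k : ℤ) :
    ∫ x in (0 : ℝ)..1, Complex.exp (-(2 * Real.pi * k * Complex.I) * x) *
      (resolventKernel ν x : ℂ) = (resolventCoeff ν k : ℂ) := by
  set w : ℝ := ν⁻¹ with hw
  have hw0 : 0 < w := by positivity
  set S : ℝ := Real.sinh (w / 2) with hS
  have hS0 : 0 < S := Real.sinh_pos_iff.2 (by positivity)
  set c : ℂ := 2 * Real.pi * k * Complex.I with hc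
  have hre : c.re = 0 := by simp [hc]
  have hplus : (-(c + w)) ≠ 0 := fun h => by
    have := congrArg Complex.re h
    simp [hre] at this
    exact hw0.ne' this
  have hminus : ((w : ℂ) - c) ≠ 0 := fun h => by
    have := congrArg Complex.re h
    simp [hre] at this
    exact hw0.ne' this
  have hS' : (S : ℂ) = (Complex.exp (w / 2) - Complex.exp (-(w / 2))) / 2 := by
    rw [hS, Complex.ofReal_sinh, Complex.sinh]
    push_cast
    rfl
  have hSne : (S : ℂ) ≠ 0 := by exact_mod_cast hS0.ne'
  have hνne : (ν : ℂ) ≠ 0 := by exact_mod_cast hν.ne'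
  have hpt : ∀ x : ℝ, Complex.exp (-c * x) * (resolventKernel ν x : ℂ) =
      (Complex.exp (w / 2) / (4 * ν * S)) * Complex.exp (-(c + w) * x) +
      (Complex.exp (-(w / 2)) / (4 * ν * S)) * Complex.exp ((w - c) * x) := by
    intro x
    have : (resolventKernel ν x : ℂ) =
        (Complex.exp (w / 2) * Complex.exp (-(w * x)) +
          Complex.exp (-(w / 2)) * Complex.exp (w * x)) / (4 * ν * S) := by
      rw [resolventKernel, ← hw, ← hS]
      push_cast
      rw [Complex.cosh, ← Complex.exp_add, ← Complex.exp_add,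
        show -(w * (1 / 2 - x) : ℂ) = -(w / 2) + w * x by ring,
        show (w * (1 / 2 - x) : ℂ) = w / 2 + -(w * x) by ring]
      field_simp
      ring
    rw [this, show -(c + w) * x = -c * x + -(w * x) by ring,
      show (w - c) * x = -c * x + w * x by ring, Complex.exp_add, Complex.exp_add]
    ring
  have hper : Complex.exp (-c) = 1 := by
    rw [Complex.exp_eq_one_iff]
    exact ⟨-k, by rw [hc]; push_cast; ring⟩
  have h2 : Complex.exp (w / 2) * Complex.exp (-(w / 2)) = 1 := by
    rw [← Complex.exp_add]; simp
  have h3 : Complex.exp (-(c + w)) = Complex.exp (-(w / 2)) * Complex.exp (-(w / 2)) := by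
    rw [neg_add, Complex.exp_add, hper, one_mul, ← Complex.exp_add]
    congr 1
    ring
  have h4 : Complex.exp (w - c) = Complex.exp (w / 2) * Complex.exp (w / 2) := by
    rw [sub_eq_add_neg, Complex.exp_add, hper, mul_one, ← Complex.exp_add]
    congr 1
    ring
  simp_rw [hpt]
  rw [intervalIntegral.integral_add (Continuous.intervalIntegrable (by fun_prop) _ _)
    (Continuous.intervalIntegrable (by fun_prop) _ _),
    intervalIntegral.integral_const_mul, intervalIntegral.integral_const_mul,
    integral_exp_mul_complex hplus, integral_exp_mul_complex hminus]
  simp only [Complex.ofReal_one, mul_one, Complex.ofReal_zero, mul_zero, Complex.exp_zero]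
  rw [h3, h4]
  have hp : (c + w) ≠ 0 := fun h => hplus (by rw [h, neg_zero])
  have hleft : Complex.exp (w / 2) / (4 * ν * S) *
      ((Complex.exp (-(w / 2)) * Complex.exp (-(w / 2)) - 1) / -(c + w)) =
      1 / (2 * ν) * (1 / (c + w)) := by
    have : Complex.exp (w / 2) * (Complex.exp (-(w / 2)) * Complex.exp (-(w / 2)) - 1) =
        - (2 * S) := by
      rw [hS']; linear_combination Complex.exp (-(w / 2)) * h2
    rw [div_mul_div_comm, this]
    field_simp
    norm_num
  have hright : Complex.exp (-(w / 2)) / (4 * ν * S) *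
      ((Complex.exp (w / 2) * Complex.exp (w / 2) - 1) / (w - c)) =
      1 / (2 * ν) * (1 / (w - c)) := by
    have : Complex.exp (-(w / 2)) * (Complex.exp (w / 2) * Complex.exp (w / 2) - 1) =
        2 * S := by
      rw [hS']; linear_combination Complex.exp (w / 2) * h2
    rw [div_mul_div_comm, this]
    field_simp
    norm_num
  rw [hleft, hright, ← mul_add, div_add_div _ _ hp hminus]
  have hprod : (c + w) * (w - c) = (w ^ 2 * (1 + 4 * Real.pi ^ 2 * ν ^ 2 * k ^ 2) : ℝ) := by
    have hwν : (w : ℂ) * ν = 1 := by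
      rw [hw]; push_cast; exact inv_mul_cancel₀ hνne
    push_cast
    rw [hc]
    linear_combination (-(2 * Real.pi * k) ^ 2 : ℂ) * Complex.I_sq -
      (4 * Real.pi ^ 2 * k ^ 2 * (w * ν + 1) : ℂ) * hwν
  rw [hprod, resolventCoeff]
  have hq : (0 : ℝ) < 1 + 4 * Real.pi ^ 2 * ν ^ 2 * k ^ 2 := by positivity
  have : (1 * ((w : ℂ) - c) + (c + w) * 1) = ((2 * w : ℝ) : ℂ) := by push_cast; ring
  rw [this]
  norm_cast
  rw [hw]
  field_simp

lemma summable_resolventCoeff {ν : ℝ} (hν : 0 < ν) :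
    Summable (fun k : ℤ => resolventCoeff ν k) := by
  refine Summable.of_nonneg_of_le (fun k => (resolventCoeff_pos ν k).le) (fun k => ?_)
    ((Real.summable_one_div_int_pow.2 one_lt_two).mul_left
      (4 * Real.pi ^ 2 * ν ^ 2)⁻¹ |>.add (summable_of_hasFiniteSupport
      (f := fun k : ℤ => if k = 0 then (1 : ℝ) else 0) ?_))
  · rcases eq_or_ne k 0 with rfl | hk
    · simp [resolventCoeff]
    · have hk' : (k : ℝ) ≠ 0 := by exact_mod_cast hk
      simp only [hk, if_false, add_zero, resolventCoeff]
      rw [one_div, ← mul_inv]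
      gcongr
      linarith
  · refine (Set.finite_singleton (0 : ℤ)).subset fun k hk => ?_
    by_contra h
    simp_all

lemma hasSum_resolventKernel {ν x : ℝ} (hν : 0 < ν) (hx : x ∈ Set.Ico (0 : ℝ) 1) :
    HasSum (fun k : ℤ => resolventCoeff ν k * Real.cos (2 * Real.pi * k * x))
      (resolventKernel ν x) := by
  have : Fact ((0 : ℝ) < 1) := ⟨one_pos⟩
  let g : ℝ → ℂ := fun y => (resolventKernel ν y : ℂ)
  have hg : Continuous g := by
    unfold g resolventKernel
    fun_prop
  have hper : g 0 = g 1 := by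
    simp only [g, resolventKernel]
    rw [show ν⁻¹ * (1 / 2 - 1) = -(ν⁻¹ * (1 / 2 - 0)) by ring, Real.cosh_neg]
  let f : C(AddCircle (1 : ℝ), ℂ) :=
    ⟨AddCircle.liftIco 1 0 g, AddCircle.liftIco_zero_continuous hper hg.continuousOn⟩
  have hcoeff : ∀ k : ℤ, fourierCoeff f k = (resolventCoeff ν k : ℂ) := by
    intro k
    change fourierCoeff (AddCircle.liftIco 1 0 g) k = _
    rw [fourierCoeff_eq_intervalIntegral _ _ 0, ← integral_fourier_mul_resolventKernel hν k]
    rw [zero_add, div_one, one_smul]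
    refine intervalIntegral.integral_congr_Ioo_of_le zero_le_one fun y hy => ?_
    simp only [smul_eq_mul]
    rw [AddCircle.liftIco_zero_coe_apply (Set.Ioo_subset_Ico_self hy), fourier_coe_apply]
    congr 2
    push_cast
    ring
  have hs : Summable (fourierCoeff f) := by
    rw [show fourierCoeff f = fun k : ℤ => (resolventCoeff ν k : ℂ) from funext hcoeff]
    exact_mod_cast summable_resolventCoeff hν
  have h := has_pointwise_sum_fourier_series_of_summable hs (x : AddCircle (1 : ℝ))
  have hfx : f (x : AddCircle (1 : ℝ)) = (resolventKernel ν x : ℂ) :=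
    AddCircle.liftIco_zero_coe_apply (f := g) hx
  rw [hfx] at h
  have h' := Complex.hasSum_re h
  rw [Complex.ofReal_re] at h'
  convert h' using 2 with k
  rw [hcoeff, fourier_coe_apply, smul_eq_mul, Complex.re_ofReal_mul,
    show (2 * Real.pi * Complex.I * k * x / (1 : ℝ) : ℂ) =
      ((2 * Real.pi * k * x : ℝ) : ℂ) * Complex.I by push_cast; ring,
    Complex.exp_ofReal_mul_I_re]

lemma tendsto_KNker_re {ν x : ℝ} (hν : 0 < ν) (hx : x ∈ Set.Ico (0 : ℝ) 1) :
    Filter.Tendsto (fun M : ℕ => (KNker ν M x).re) Filter.atTop (nhds (resolventKernel ν x)) := by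
  simp_rw [KNker_re_eq_sum_Icc]
  exact (hasSum_resolventKernel hν hx).comp Finset.tendsto_Icc_neg

/-- Two summations by parts compare the truncated kernel with the full one, up to the leading
boundary term. -/
lemma KNker_re_le {ν x : ℝ} (hν : 0 < ν) (hx : x ∈ Set.Ioo (0 : ℝ) 1) {N : ℕ}
    (hN : 1 ≤ 3 * (4 * Real.pi ^ 2 * ν ^ 2) * (N : ℝ) ^ 2) :
    (KNker ν N x).re ≤ resolventKernel ν x +
      resolventCoeff ν (N + 1) *
        (Real.sin (Real.pi * (2 * N + 1) * x) / Real.sin (Real.pi * x)) +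
      (resolventCoeff ν (N + 1) - resolventCoeff ν (N + 2)) / Real.sin (Real.pi * x) ^ 2 := by
  set S := Real.sin (Real.pi * x) with hS
  have hS0 : 0 < S := Real.sin_pos_of_pos_of_lt_pi (mul_pos Real.pi_pos hx.1)
    (by nlinarith [Real.pi_pos, hx.2])
  let P : ℕ → ℝ := fun M => (KNker ν M x).re -
    resolventCoeff ν (M + 1) * (Real.sin (Real.pi * (2 * M + 1) * x) / S) +
    (resolventCoeff ν (M + 1) - resolventCoeff ν (M + 2)) *
      ((Real.cos (2 * Real.pi * (M + 1) * x) - 1) / (2 * S ^ 2))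
  have hstep : ∀ M : ℕ, N ≤ M → P M ≤ P (M + 1) := by
    intro M hM
    have hM' : (N : ℝ) ≤ M := by exact_mod_cast hM
    have hconv := resolventCoeff_midpoint_le (ν := ν) (t := (M : ℝ) + 2) (by
      have : 0 ≤ 4 * Real.pi ^ 2 * ν ^ 2 := by positivity
      have h0 : (0 : ℝ) ≤ N := by positivity
      have h2 : (N : ℝ) ^ 2 + 1 ≤ ((M : ℝ) + 2) ^ 2 := by nlinarith
      nlinarith)
    have hsin : 2 * Real.cos (2 * Real.pi * (M + 1) * x) * S =
        Real.sin (Real.pi * (2 * (M + 1) + 1) * x) - Real.sin (Real.pi * (2 * M + 1) * x) := by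
      rw [show Real.pi * (2 * (M + 1) + 1) * x = 2 * Real.pi * (M + 1) * x + Real.pi * x by ring,
        show Real.pi * (2 * M + 1) * x = 2 * Real.pi * (M + 1) * x - Real.pi * x by ring,
        Real.sin_add, Real.sin_sub]
      ring
    have hcos : 2 * Real.sin (Real.pi * (2 * (M + 1) + 1) * x) * S =
        Real.cos (2 * Real.pi * (M + 1) * x) - Real.cos (2 * Real.pi * (M + 1 + 1) * x) := by
      rw [show 2 * Real.pi * (M + 1) * x = Real.pi * (2 * (M + 1) + 1) * x - Real.pi * x by ring,
        show 2 * Real.pi * (M + 1 + 1) * x = Real.pi * (2 * (M + 1) + 1) * x + Real.pi * x by ring,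
        Real.cos_add, Real.cos_sub]
      ring
    have hdiff : P (M + 1) - P M =
        (resolventCoeff ν (M + 1) + resolventCoeff ν (M + 3) - 2 * resolventCoeff ν (M + 2)) *
          ((1 - Real.cos (2 * Real.pi * (M + 1 + 1) * x)) / (2 * S ^ 2)) := by
      simp only [P, KNker_re_succ]
      push_cast
      rw [show (M : ℝ) + 1 + 1 = M + 2 by ring, show (M : ℝ) + 1 + 2 = M + 3 by ring] at *
      generalize resolventCoeff ν (M + 1) = a1
      generalize resolventCoeff ν (M + 2) = a2
      generalize resolventCoeff ν (M + 3) = a3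
      generalize Real.cos (2 * Real.pi * (M + 1) * x) = c1 at *
      generalize Real.cos (2 * Real.pi * (M + 2) * x) = c2 at *
      generalize Real.sin (Real.pi * (2 * (M + 1) + 1) * x) = s2 at *
      generalize Real.sin (Real.pi * (2 * M + 1) * x) = s1 at *
      field_simp
      linear_combination (2 * S * a1) * hsin + (a1 - a2) * hcos
    have : 0 ≤ P (M + 1) - P M := by
      rw [hdiff]
      have hc1 := Real.cos_le_one (2 * Real.pi * (M + 1 + 1) * x)
      refine mul_nonneg ?_ (div_nonneg (by linarith) (by positivity))
      rw [show (M : ℝ) + 2 - 1 = M + 1 by ring, show (M : ℝ) + 2 + 1 = M + 3 by ring] at hconv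
      linarith
    linarith
  have ha := tendsto_resolventCoeff hν
  have ha1 : Filter.Tendsto (fun M : ℕ => resolventCoeff ν (M + 1)) Filter.atTop (nhds 0) := by
    exact_mod_cast (Filter.tendsto_add_atTop_iff_nat 1).2 ha
  have ha2 : Filter.Tendsto (fun M : ℕ => resolventCoeff ν (M + 2)) Filter.atTop (nhds 0) := by
    exact_mod_cast (Filter.tendsto_add_atTop_iff_nat 2).2 ha
  have hlim : Filter.Tendsto P Filter.atTop (nhds (resolventKernel ν x - 0 + 0)) := by
    refine ((tendsto_KNker_re hν ⟨hx.1.le, hx.2⟩).sub ?_).add ?_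
    · refine ha1.zero_mul_isBoundedUnder_le ?_
      refine Filter.isBoundedUnder_of ⟨1 / S, fun M => ?_⟩
      simp only [Function.comp, Real.norm_eq_abs, abs_div, abs_of_pos hS0]
      gcongr
      exact Real.abs_sin_le_one _
    · refine Filter.Tendsto.zero_mul_isBoundedUnder_le (by simpa using ha1.sub ha2) ?_
      refine Filter.isBoundedUnder_of ⟨2 / (2 * S ^ 2), fun M => ?_⟩
      simp only [Function.comp, Real.norm_eq_abs, abs_div,
        abs_of_pos (show 0 < 2 * S ^ 2 by positivity)]
      gcongr
      rw [abs_le]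
      constructor <;> linarith [Real.cos_le_one (2 * Real.pi * (M + 1) * x),
        Real.neg_one_le_cos (2 * Real.pi * (M + 1) * x)]
  have hle : P N ≤ resolventKernel ν x - 0 + 0 := by
    have hmono : Monotone fun j => P (j + N) := monotone_nat_of_le_succ fun j => by
      rw [show j + 1 + N = j + N + 1 by ring]
      exact hstep (j + N) (Nat.le_add_left N j)
    simpa using hmono.ge_of_tendsto ((Filter.tendsto_add_atTop_iff_nat N).2 hlim) 0
  have hd : 0 ≤ resolventCoeff ν (N + 1) - resolventCoeff ν (N + 2) := by
    unfold resolventCoeff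
    rw [sub_nonneg]
    gcongr
    norm_num
  have hfin : (resolventCoeff ν (N + 1) - resolventCoeff ν (N + 2)) *
      ((1 - Real.cos (2 * Real.pi * (N + 1) * x)) / (2 * S ^ 2)) ≤
      (resolventCoeff ν (N + 1) - resolventCoeff ν (N + 2)) / S ^ 2 := by
    rw [div_eq_mul_one_div _ (S ^ 2)]
    refine mul_le_mul_of_nonneg_left ?_ hd
    rw [div_le_div_iff₀ (by positivity) (by positivity)]
    nlinarith [Real.neg_one_le_cos (2 * Real.pi * (N + 1) * x), sq_nonneg S]
  simp only [P] at hle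
  have : (Real.cos (2 * Real.pi * (N + 1) * x) - 1) / (2 * S ^ 2) =
      -((1 - Real.cos (2 * Real.pi * (N + 1) * x)) / (2 * S ^ 2)) := by ring
  rw [this] at hle
  linarith

lemma sin_pi_mul_sq_ge {x : ℝ} (hx : x ∈ Set.Icc (1 / 3 : ℝ) (2 / 3)) :
    3 / 4 ≤ Real.sin (Real.pi * x) ^ 2 := by
  have hc : |Real.cos (Real.pi * x)| ≤ 1 / 2 := by
    have hpi := Real.pi_pos
    rw [abs_le]
    constructor
    · rw [show (-(1 / 2) : ℝ) = Real.cos (Real.pi - Real.pi / 3) by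
        rw [Real.cos_pi_sub, Real.cos_pi_div_three]]
      exact Real.cos_le_cos_of_nonneg_of_le_pi (by nlinarith [hx.1]) (by linarith)
        (by nlinarith [hx.2])
    · rw [← Real.cos_pi_div_three]
      exact Real.cos_le_cos_of_nonneg_of_le_pi (by linarith) (by nlinarith [hx.2])
        (by nlinarith [hx.1])
  have h2 : Real.cos (Real.pi * x) ^ 2 ≤ (1 / 2) ^ 2 := sq_le_sq' (abs_le.1 hc).1 (abs_le.1 hc).2
  nlinarith [Real.sin_sq_add_cos_sq (Real.pi * x)]

lemma resolventKernel_le {ν x : ℝ} (hν : 0 < ν) (hν' : ν ≤ 1)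
    (hx : x ∈ Set.Icc (1 / 3 : ℝ) (2 / 3)) :
    resolventKernel ν x ≤ 2 * Real.exp (-(1 / (3 * ν))) / ν := by
  have hw : 1 ≤ ν⁻¹ := (one_le_inv₀ hν).2 hν'
  have hcosh : Real.cosh (ν⁻¹ * (1 / 2 - x)) ≤ Real.exp (ν⁻¹ / 6) := by
    have h1 : Real.cosh (ν⁻¹ * (1 / 2 - x)) ≤ Real.cosh (ν⁻¹ / 6) := by
      rw [Real.cosh_le_cosh, abs_mul, abs_of_pos (inv_pos.2 hν),
        abs_of_pos (div_pos (inv_pos.2 hν) (by norm_num)), div_eq_mul_one_div ν⁻¹]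
      gcongr
      rw [abs_le]
      constructor <;> linarith [hx.1, hx.2]
    refine h1.trans ?_
    rw [Real.cosh_eq]
    have : Real.exp (-(ν⁻¹ / 6)) ≤ Real.exp (ν⁻¹ / 6) := Real.exp_le_exp.2 (by linarith)
    linarith
  have hsinh : Real.exp (ν⁻¹ / 2) / 4 ≤ Real.sinh (ν⁻¹ / 2) := by
    rw [Real.sinh_eq]
    have h1 : Real.exp (-(ν⁻¹ / 2)) * 2 ≤ Real.exp (ν⁻¹ / 2) := by
      have : Real.exp (ν⁻¹ / 2) = Real.exp (-(ν⁻¹ / 2)) * Real.exp ν⁻¹ := by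
        rw [← Real.exp_add]; ring_nf
      rw [this]
      gcongr
      linarith [Real.add_one_le_exp ν⁻¹]
    linarith
  have hE : Real.exp (-(1 / (3 * ν))) * Real.exp (ν⁻¹ / 2) = Real.exp (ν⁻¹ / 6) := by
    rw [← Real.exp_add]
    congr 1
    field_simp
    norm_num
  unfold resolventKernel
  have hs0 : 0 < Real.sinh (ν⁻¹ / 2) := lt_of_lt_of_le (by positivity) hsinh
  rw [div_le_div_iff₀ (by positivity) hν]
  calc Real.cosh (ν⁻¹ * (1 / 2 - x)) * ν ≤ Real.exp (ν⁻¹ / 6) * ν := by gcongr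
    _ = 2 * Real.exp (-(1 / (3 * ν))) * (2 * ν * (Real.exp (ν⁻¹ / 2) / 4)) := by
        rw [← hE]; ring
    _ ≤ _ := by gcongr

lemma resolventCoeff_sub_le {ν : ℝ} (hν : 0 < ν) {n : ℝ} (hn : 0 < n) :
    resolventCoeff ν (n + 1) - resolventCoeff ν (n + 2) ≤
      resolventCoeff ν (n + 1) * (2 / n) := by
  unfold resolventCoeff
  have hb : 0 < 4 * Real.pi ^ 2 * ν ^ 2 := by positivity
  generalize 4 * Real.pi ^ 2 * ν ^ 2 = b at *
  have h1 : 0 < 1 + b * (n + 1) ^ 2 := by positivity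
  have h2 : 0 < 1 + b * (n + 2) ^ 2 := by positivity
  have key : (1 + b * (n + 1) ^ 2)⁻¹ - (1 + b * (n + 2) ^ 2)⁻¹ =
      (1 + b * (n + 1) ^ 2)⁻¹ * (b * (2 * n + 3) / (1 + b * (n + 2) ^ 2)) := by
    field_simp
    ring
  rw [key]
  gcongr ?_ * ?_
  rw [div_le_div_iff₀ h2 hn]
  nlinarith [mul_pos hb hn]

/-- A positive proportion of `[1/3, 2/3]` lies where a high-frequency sine is below `-0.4`. -/
lemma volume_sin_lt_ge {L : ℝ} (hL : 100 ≤ L) :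
    ENNReal.ofReal (1 / 50) ≤
      volume {x ∈ Set.Ioc (1 / 3 : ℝ) (2 / 3) | Real.sin (Real.pi * L * x) < -0.4} := by
  set E := {x ∈ Set.Ioc (1 / 3 : ℝ) (2 / 3) | Real.sin (Real.pi * L * x) < -0.4} with hE
  have hEm : MeasurableSet E :=
    measurableSet_Ioc.inter (measurableSet_lt
      (f := fun x => Real.sin (Real.pi * L * x)) (by fun_prop) measurable_const)
  have hEfin : volume E ≠ ⊤ :=
    ((measure_mono (Set.sep_subset _ _)).trans_lt measure_Ioc_lt_top).ne
  set φ : ℝ → ℝ := fun x => (Real.sin (Real.pi * L * x) + 0.4) * (Real.sin (Real.pi * L * x) - 1)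
    with hφ
  have hφc : Continuous φ := by unfold φ; fun_prop
  have hpL : 0 < Real.pi * L := mul_pos Real.pi_pos (by linarith)
  set Φ : ℝ → ℝ := fun x => 0.1 * x - Real.sin (2 * (Real.pi * L) * x) / (4 * (Real.pi * L)) +
    0.6 * (Real.cos (Real.pi * L * x) / (Real.pi * L)) with hΦ
  have hder : ∀ x, HasDerivAt Φ (φ x) x := by
    intro x
    have h1 : HasDerivAt (fun x => Real.sin (2 * (Real.pi * L) * x))
        (Real.cos (2 * (Real.pi * L) * x) * (2 * (Real.pi * L))) x := by
      simpa using ((hasDerivAt_id x).const_mul (2 * (Real.pi * L))).sin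
    have h2 : HasDerivAt (fun x => Real.cos (Real.pi * L * x))
        (-Real.sin (Real.pi * L * x) * (Real.pi * L)) x := by
      simpa using ((hasDerivAt_id x).const_mul (Real.pi * L)).cos
    have h3 := (((hasDerivAt_id x).const_mul 0.1).sub (h1.div_const (4 * (Real.pi * L)))).add
      ((h2.div_const (Real.pi * L)).const_mul 0.6)
    refine h3.congr_deriv ?_
    rw [show 2 * (Real.pi * L) * x = 2 * (Real.pi * L * x) by ring, Real.cos_two_mul,
      Real.cos_sq', hφ]
    field_simp
    ring
  have hint : ∫ x in (1 / 3 : ℝ)..(2 / 3), φ x = Φ (2 / 3) - Φ (1 / 3) :=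
    intervalIntegral.integral_eq_sub_of_hasDerivAt (fun x _ => hder x)
      (hφc.intervalIntegrable _ _)
  have hlow : 1 / 40 ≤ ∫ x in (1 / 3 : ℝ)..(2 / 3), φ x := by
    rw [hint]
    have hpL' : 300 ≤ Real.pi * L := by nlinarith [Real.pi_gt_three]
    generalize Real.pi * L = q at *
    have hq : ∀ x, |Φ x - 0.1 * x| ≤ 0.85 / 300 := by
      intro x
      have hx : Φ x - 0.1 * x =
          (-Real.sin (2 * q * x) / 4 + 0.6 * Real.cos (q * x)) / q := by
        simp only [hΦ]
        field_simp
        ring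
      rw [hx, abs_div, abs_of_pos hpL]
      gcongr
      rw [abs_le]
      constructor <;> linarith [Real.sin_le_one (2 * q * x), Real.neg_one_le_sin (2 * q * x),
        Real.cos_le_one (q * x), Real.neg_one_le_cos (q * x)]
    have h1 := (abs_le.1 (hq (2 / 3))).1
    have h2 := (abs_le.1 (hq (1 / 3))).2
    norm_num at h1 h2 ⊢
    linarith
  have hup : ∫ x in (1 / 3 : ℝ)..(2 / 3), φ x ≤ 1.2 * (volume E).toReal := by
    rw [intervalIntegral.integral_of_le (by norm_num)]
    have hind : ∫ x in Set.Ioc (1 / 3 : ℝ) (2 / 3), E.indicator (fun _ => (1.2 : ℝ)) x =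
        1.2 * (volume E).toReal := by
      rw [setIntegral_indicator hEm, Set.inter_eq_right.2 (Set.sep_subset _ _), setIntegral_const,
        smul_eq_mul, mul_comm, Measure.real]
    rw [← hind]
    refine setIntegral_mono_on hφc.integrableOn_Ioc
      ((integrableOn_const (by simp)).indicator hEm) measurableSet_Ioc fun x hx => ?_
    have hs1 := Real.neg_one_le_sin (Real.pi * L * x)
    have hs2 := Real.sin_le_one (Real.pi * L * x)
    by_cases hxE : x ∈ E
    · rw [Set.indicator_of_mem hxE]
      simp only [hφ]
      nlinarith [hxE.2]
    · rw [Set.indicator_of_notMem hxE]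
      have : -0.4 ≤ Real.sin (Real.pi * L * x) := by
        by_contra h
        exact hxE ⟨hx, not_le.1 h⟩
      simp only [hφ]
      nlinarith
  rw [ENNReal.ofReal_le_iff_le_toReal hEfin]
  linarith

lemma integral_KNker_re (ν : ℝ) (N : ℕ) :
    ∫ x in Set.Ico (0 : ℝ) 1, (KNker ν N x).re = 1 := by
  rw [integral_Ico_eq_integral_Ioc, ← intervalIntegral.integral_of_le zero_le_one]
  induction N with
  | zero => simp [KNker_re_eq_sum_range, resolventCoeff_zero]; norm_num
  | succ n ih =>
    simp_rw [KNker_re_succ]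
    have hc : Continuous fun x => (KNker ν n x).re :=
      Complex.continuous_re.comp (continuous_KNker ν n)
    rw [intervalIntegral.integral_add (hc.intervalIntegrable _ _)
      (Continuous.intervalIntegrable (by fun_prop) _ _), ih, intervalIntegral.integral_const_mul,
      intervalIntegral.integral_comp_mul_left Real.cos (by positivity), integral_cos]
    have : Real.sin (2 * Real.pi * (n + 1)) = 0 := by
      rw [Real.sin_eq_zero_iff]
      exact ⟨2 * (n + 1), by push_cast; ring⟩
    simp [this]

/-- Negativity of the real part on a set of positive measure makes the `L¹` norm exceed `1`. -/
lemma one_add_le_integral_norm_KNker {ν t m : ℝ} {N : ℕ} (ht : 0 ≤ t)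
    (h : ENNReal.ofReal m ≤ volume {x ∈ Set.Ico (0 : ℝ) 1 | (KNker ν N x).re < -t}) :
    1 + 2 * t * m ≤ ∫ x in Set.Ico (0 : ℝ) 1, ‖KNker ν N x‖ := by
  set E := {x ∈ Set.Ico (0 : ℝ) 1 | (KNker ν N x).re < -t} with hE
  have hc : Continuous fun x => (KNker ν N x).re :=
    Complex.continuous_re.comp (continuous_KNker ν N)
  have hEm : MeasurableSet E :=
    measurableSet_Ico.inter (measurableSet_lt hc.measurable measurable_const)
  have hEfin : volume E ≠ ⊤ :=
    ((measure_mono (Set.sep_subset _ _)).trans_lt measure_Ico_lt_top).ne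
  have hm' : m ≤ (volume E).toReal := (ENNReal.ofReal_le_iff_le_toReal hEfin).1 h
  have hind : ∫ x in Set.Ico (0 : ℝ) 1, E.indicator (fun _ => 2 * t) x =
      2 * t * (volume E).toReal := by
    rw [setIntegral_indicator hEm, Set.inter_eq_right.2 (Set.sep_subset _ _), setIntegral_const,
      smul_eq_mul, mul_comm, Measure.real]
  have hint1 : IntegrableOn (fun x => (KNker ν N x).re) (Set.Ico 0 1) :=
    hc.integrableOn_Icc.mono_set Set.Ico_subset_Icc_self
  have hint2 : IntegrableOn (E.indicator fun _ => 2 * t) (Set.Ico 0 1) :=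
    (integrableOn_const (by simp)).indicator hEm
  calc 1 + 2 * t * m ≤ 1 + 2 * t * (volume E).toReal := by gcongr
    _ = ∫ x in Set.Ico (0 : ℝ) 1, ((KNker ν N x).re + E.indicator (fun _ => 2 * t) x) := by
        rw [integral_add hint1 hint2, integral_KNker_re, hind]
    _ ≤ _ := by
        refine setIntegral_mono_on (hint1.add hint2)
          ((continuous_KNker ν N).norm.integrableOn_Icc.mono_set Set.Ico_subset_Icc_self)
          measurableSet_Ico fun x _ => le_trans ?_ (Complex.abs_re_le_norm _)
        by_cases hxE : x ∈ E
        · rw [Set.indicator_of_mem hxE]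
          linarith [hxE.2, neg_le_abs (KNker ν N x).re]
        · rw [Set.indicator_of_notMem hxE, add_zero]
          exact le_abs_self _

/-- There exist absolute constants `ν₀, c₀, γ₁ > 0` such that for every
`0 < ν < ν₀` and every integer `N` with `1/(2√3 π ν) ≤ N ≤ c₀ ν^{-1/2} e^{1/(6ν)}`: the set
of `x ∈ 𝕋` where `K_N(x) < −0.3/(1 + 4π²ν²(N+1)²)` has Lebesgue measure at least `γ₁`, and
`‖K_N‖_{L¹(𝕋)} ≥ 1 + γ₁/(1 + 4π²ν²(N+1)²)`. -/
theorem statement12 :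
    ∃ ν₀ c₀ γ₁ : ℝ, 0 < ν₀ ∧ 0 < c₀ ∧ 0 < γ₁ ∧
      ∀ ν : ℝ, 0 < ν → ν < ν₀ → ∀ N : ℕ,
        1 / (2 * Real.sqrt 3 * Real.pi * ν) ≤ (N : ℝ) →
        (N : ℝ) ≤ c₀ / Real.sqrt ν * Real.exp (1 / (6 * ν)) →
          ENNReal.ofReal γ₁ ≤
            volume {x ∈ Set.Ico (0 : ℝ) 1 |
              (KNker ν N x).re
                < -(0.3 / (1 + 4 * Real.pi ^ 2 * ν ^ 2 * ((N : ℝ) + 1) ^ 2))} ∧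
          1 + γ₁ / (1 + 4 * Real.pi ^ 2 * ν ^ 2 * ((N : ℝ) + 1) ^ 2)
              ≤ ∫ x in Set.Ico (0 : ℝ) 1, ‖KNker ν N x‖ := by
  refine ⟨1 / 1000, 1 / 200, 1 / 100, by norm_num, by norm_num, by norm_num, ?_⟩
  intro ν hν hν' N hN1 hN2
  have hpi3 := Real.pi_gt_three
  have hpi4 : Real.pi < 3.15 := Real.pi_lt_d2
  have hs3 : Real.sqrt 3 ^ 2 = 3 := Real.sq_sqrt (by norm_num)
  have hs3' : 0 < Real.sqrt 3 := by positivity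
  rw [div_le_iff₀ (by positivity)] at hN1
  have hN60 : (60 : ℝ) ≤ N := by
    by_contra! hlt
    have h2 : Real.sqrt 3 ≤ 2 := by nlinarith
    have h1 : 2 * Real.sqrt 3 * Real.pi ≤ 13 := by nlinarith
    have h3 : 2 * Real.sqrt 3 * Real.pi * ν ≤ 13 * (1 / 1000) := by gcongr
    have h4 : (N : ℝ) * (2 * Real.sqrt 3 * Real.pi * ν) ≤ 60 * (13 * (1 / 1000)) := by gcongr
    norm_num at h4
    linarith
  have hN0 : (0 : ℝ) < N := by linarith
  have hconv : 1 ≤ 3 * (4 * Real.pi ^ 2 * ν ^ 2) * (N : ℝ) ^ 2 := by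
    have : 3 * (4 * Real.pi ^ 2 * ν ^ 2) * (N : ℝ) ^ 2 =
        ((N : ℝ) * (2 * Real.sqrt 3 * Real.pi * ν)) ^ 2 := by
      linear_combination (-4 * Real.pi ^ 2 * ν ^ 2 * (N : ℝ) ^ 2) * hs3
    rw [this]
    exact one_le_pow₀ hN1
  set a := resolventCoeff ν (N + 1) with ha
  have ha0 : 0 < a := resolventCoeff_pos _ _
  have haD : (1 + 4 * Real.pi ^ 2 * ν ^ 2 * ((N : ℝ) + 1) ^ 2) = a⁻¹ := by
    rw [ha, resolventCoeff, inv_inv]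
  have hkernel : 2 * Real.exp (-(1 / (3 * ν))) / ν ≤ 0.02 * a := by
    have hNsq : (N : ℝ) ^ 2 ≤ (1 / 200) ^ 2 / ν * Real.exp (1 / (3 * ν)) := by
      calc (N : ℝ) ^ 2 ≤ (1 / 200 / Real.sqrt ν * Real.exp (1 / (6 * ν))) ^ 2 := by gcongr
        _ = _ := by
          rw [mul_pow, div_pow, Real.sq_sqrt hν.le, ← Real.exp_nat_mul]
          congr 2
          push_cast
          field_simp
          norm_num
    have hD : a⁻¹ ≤ 7 * (4 * Real.pi ^ 2 * ν ^ 2) * (N : ℝ) ^ 2 := by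
      rw [← haD]
      have h2 : ((N : ℝ) + 1) ^ 2 ≤ 4 * (N : ℝ) ^ 2 := by nlinarith
      have hb : 0 ≤ 4 * Real.pi ^ 2 * ν ^ 2 := by positivity
      nlinarith
    have hpisq : Real.pi ^ 2 ≤ 10 := by nlinarith
    have hD' : a⁻¹ ≤ 280 * ν * ((1 / 200) ^ 2 * Real.exp (1 / (3 * ν))) := by
      calc a⁻¹ ≤ 7 * (4 * 10 * ν ^ 2) * ((1 / 200) ^ 2 / ν * Real.exp (1 / (3 * ν))) :=
            hD.trans (by gcongr)
        _ = _ := by field_simp; norm_num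
    have hE : Real.exp (-(1 / (3 * ν))) * Real.exp (1 / (3 * ν)) = 1 := by
      rw [← Real.exp_add]; simp
    have : 2 * Real.exp (-(1 / (3 * ν))) / ν * a⁻¹ ≤ 0.02 := by
      calc 2 * Real.exp (-(1 / (3 * ν))) / ν * a⁻¹
          ≤ 2 * Real.exp (-(1 / (3 * ν))) / ν *
            (280 * ν * ((1 / 200) ^ 2 * Real.exp (1 / (3 * ν)))) := by gcongr
        _ = 560 / 40000 * (Real.exp (-(1 / (3 * ν))) * Real.exp (1 / (3 * ν))) := by
            field_simp; norm_num
        _ ≤ 0.02 := by rw [hE]; norm_num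
    rwa [← div_eq_mul_inv, div_le_iff₀ ha0] at this
  have hvol : ENNReal.ofReal (1 / 50) ≤ volume {x ∈ Set.Ico (0 : ℝ) 1 |
      (KNker ν N x).re < -(0.3 * a)} := by
    refine (volume_sin_lt_ge (L := 2 * N + 1) (by linarith)).trans (measure_mono ?_)
    rintro x ⟨hx, hsin⟩
    have hxI : x ∈ Set.Icc (1 / 3 : ℝ) (2 / 3) := Set.Ioc_subset_Icc_self hx
    have hx01 : x ∈ Set.Ioo (0 : ℝ) 1 := ⟨by linarith [hx.1], by linarith [hx.2]⟩
    refine ⟨⟨hx01.1.le, hx01.2⟩, ?_⟩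
    have hS2 := sin_pi_mul_sq_ge hxI
    have hS0 : 0 < Real.sin (Real.pi * x) :=
      Real.sin_pos_of_pos_of_lt_pi (mul_pos Real.pi_pos hx01.1) (by nlinarith [hx01.2])
    have hmain := KNker_re_le hν hx01 hconv
    rw [← ha] at hmain
    have h1 := (resolventKernel_le hν (by linarith) hxI).trans hkernel
    have h2 : a * (Real.sin (Real.pi * (2 * N + 1) * x) / Real.sin (Real.pi * x)) ≤
        a * (-0.4) := by
      gcongr
      rw [div_le_iff₀ hS0]
      nlinarith [Real.sin_le_one (Real.pi * x)]
    have h3 : (a - resolventCoeff ν (N + 2)) / Real.sin (Real.pi * x) ^ 2 ≤ 0.05 * a := by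
      rw [div_le_iff₀ (by positivity)]
      have h4 : a - resolventCoeff ν (N + 2) ≤ a * (2 / N) := resolventCoeff_sub_le hν hN0
      have h5 : (2 : ℝ) / N ≤ 2 / 60 := by gcongr
      nlinarith
    nlinarith
  rw [haD, div_inv_eq_mul, div_inv_eq_mul]
  refine ⟨(ENNReal.ofReal_le_ofReal (by norm_num)).trans hvol, ?_⟩
  have := one_add_le_integral_norm_KNker (by positivity) hvol
  linarith

end
end

section
/- Let φ be a Schwartz function on ℝ with Fourier transform φ̂(ξ) = ∫_ℝ φ(y) e^{−2πiξy} dy, and for each integer N ≥ 2 define Q_N(D_N)(x) = ∫_ℝ φ(y) · D_N(x − y/N) dy, where D_N(z) = sin((2N+1)πz)/sin(πz) is the (1-periodic) Dirichlet kernel. Then: (i) if φ̂(1) = 0, then ‖Q_N(D_N)‖_{L¹(𝕋)} / log N → 0 as N → ∞; (ii) if φ̂(1) ≠ 0, then there exist N₀ depending on φ and absolute constants c₁ > 0, c₂ > 0 such that for all N ≥ N₀, c₁ |φ̂(1)| log N ≤ ‖Q_N(D_N)‖_{L¹(𝕋)} ≤ c₂ |φ̂(1)| log N. -/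
open MeasureTheory

noncomputable section

/-- The Dirichlet kernel `D_N(z) = ∑_{|k| ≤ N} e^{2πikz}`, a real-valued continuous
1-periodic function on `ℝ` (equal to `sin((2N+1)πz)/sin(πz)` wherever `sin(πz) ≠ 0`). -/
def dirichlet (N : ℕ) (z : ℝ) : ℝ :=
  (∑ k ∈ Finset.Icc (-(N : ℤ)) (N : ℤ),
    Complex.exp (2 * Real.pi * Complex.I * ((k : ℝ) * z))).re

/-- `Q_N(D_N)(x) = ∫_ℝ φ(y) D_N(x − y/N) dy`. -/
def QDirichlet (φ : SchwartzMap ℝ ℝ) (N : ℕ) (x : ℝ) : ℝ :=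
  ∫ y : ℝ, φ y * dirichlet N (x - y / N)

/-- `φ̂(1) = ∫_ℝ φ(y) e^{−2πiy} dy`. -/
def hatPhiOne (φ : SchwartzMap ℝ ℝ) : ℂ :=
  ∫ y : ℝ, (φ y : ℂ) * Complex.exp (-(2 * Real.pi * Complex.I * y))

/-- The character `t ↦ e^{2πit}` of `ℝ`. -/
def character (t : ℝ) : ℂ :=
  Complex.exp (2 * Real.pi * Complex.I * t)

lemma character_add (s t : ℝ) : character (s + t) = character s * character t := by
  simp only [character, ← Complex.exp_add]
  push_cast
  ring_nf

lemma character_zero : character 0 = 1 := by simp [character]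

lemma character_natCast_mul (n : ℕ) (t : ℝ) : character (n * t) = character t ^ n := by
  simp only [character, ← Complex.exp_nat_mul]
  push_cast
  ring_nf

lemma norm_character (t : ℝ) : ‖character t‖ = 1 := by
  rw [character, show (2 * Real.pi * Complex.I * t : ℂ) = ((2 * Real.pi * t : ℝ) : ℂ) * Complex.I by
    push_cast; ring, Complex.norm_exp_ofReal_mul_I]

lemma conj_character (t : ℝ) : (starRingEnd ℂ) (character t) = character (-t) := by
  simp [character, ← Complex.exp_conj, map_ofNat]

lemma character_neg_natCast (n : ℕ) : character (-n) = 1 := by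
  rw [character, Complex.exp_eq_one_iff]
  exact ⟨-n, by push_cast; ring⟩

lemma continuous_character : Continuous character := by
  unfold character
  fun_prop

lemma norm_character_sub_one (t : ℝ) : ‖character t - 1‖ = 2 * |Real.sin (Real.pi * t)| := by
  rw [character, show (2 * Real.pi * Complex.I * t : ℂ) = Complex.I * ((2 * Real.pi * t : ℝ) : ℂ) by
    push_cast; ring, Complex.norm_exp_I_mul_ofReal_sub_one]
  rw [norm_mul, Real.norm_ofNat, Real.norm_eq_abs]
  ring_nf

lemma norm_character_sub_one_le (t : ℝ) : ‖character t - 1‖ ≤ 2 * Real.pi * |t| := by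
  rw [norm_character_sub_one]
  have := Real.abs_sin_le_abs (x := Real.pi * t)
  rw [abs_mul, abs_of_pos Real.pi_pos] at this
  linarith

/-- The Dirichlet kernel as a complex trigonometric sum, listed from the top frequency down. -/
lemma dirichlet_eq_sum (N : ℕ) (z : ℝ) :
    (dirichlet N z : ℂ) = ∑ m ∈ Finset.range (2 * N + 1), character ((N - m) * z) := by
  have hsum : ∑ k ∈ Finset.Icc (-(N : ℤ)) (N : ℤ),
      Complex.exp (2 * Real.pi * Complex.I * ((k : ℝ) * z)) =
      ∑ m ∈ Finset.range (2 * N + 1), character ((N - m) * z) := by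
    symm
    refine Finset.sum_bij (fun m _ => (N : ℤ) - m) ?_ ?_ ?_ ?_
    · intro m hm
      simp only [Finset.mem_range, Finset.mem_Icc] at *
      omega
    · intro a _ b _ h
      simpa using h
    · intro k hk
      simp only [Finset.mem_Icc] at hk
      exact ⟨(N - k).toNat, by simp only [Finset.mem_range]; omega, by omega⟩
    · intro m _
      simp [character]
  have hreal : (starRingEnd ℂ) (∑ m ∈ Finset.range (2 * N + 1), character ((N - m) * z)) =
      ∑ m ∈ Finset.range (2 * N + 1), character ((N - m) * z) := by
    rw [map_sum, ← Finset.sum_range_reflect (fun m : ℕ => character ((N - m) * z))]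
    refine Finset.sum_congr rfl fun m hm => ?_
    rw [conj_character]
    congr 1
    rw [show 2 * N + 1 - 1 - m = 2 * N - m by omega,
      Nat.cast_sub (by simp only [Finset.mem_range] at hm; omega)]
    push_cast
    ring
  rw [dirichlet, hsum]
  exact Complex.conj_eq_iff_re.mp hreal

/-- The Fourier transform of `φ`. -/
def hatPhi (φ : SchwartzMap ℝ ℝ) (t : ℝ) : ℂ :=
  ∫ y : ℝ, (φ y : ℂ) * character (-(t * y))

lemma hatPhi_one (φ : SchwartzMap ℝ ℝ) : hatPhi φ 1 = hatPhiOne φ := by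
  simp [hatPhi, hatPhiOne, character]

lemma hatPhi_neg (φ : SchwartzMap ℝ ℝ) (t : ℝ) :
    hatPhi φ (-t) = (starRingEnd ℂ) (hatPhi φ t) := by
  rw [hatPhi, hatPhi, ← integral_conj]
  simp [conj_character]

lemma integrable_mul_character (φ : SchwartzMap ℝ ℝ) (t : ℝ) :
    Integrable fun y : ℝ => (φ y : ℂ) * character (-(t * y)) := by
  refine φ.integrable.ofReal.mul_bdd (c := 1) ?_ ?_
  · exact (continuous_character.comp (by fun_prop)).aestronglyMeasurable
  · exact Filter.Eventually.of_forall fun y => (norm_character _).le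

lemma norm_hatPhi_le (φ : SchwartzMap ℝ ℝ) (t : ℝ) : ‖hatPhi φ t‖ ≤ ∫ y : ℝ, ‖φ y‖ := by
  refine (norm_integral_le_integral_norm _).trans_eq ?_
  simp [norm_character]

lemma norm_hatPhi_sub_le (φ : SchwartzMap ℝ ℝ) (s t : ℝ) :
    ‖hatPhi φ s - hatPhi φ t‖ ≤ 2 * Real.pi * (∫ y : ℝ, ‖y‖ ^ 1 * ‖φ y‖) * |s - t| := by
  rw [hatPhi, hatPhi, ← integral_sub (integrable_mul_character φ s) (integrable_mul_character φ t),
    ← integral_const_mul, ← integral_mul_const]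
  refine norm_integral_le_of_norm_le (((φ.integrable_pow_mul volume 1).const_mul _).mul_const _)
    (Filter.Eventually.of_forall fun y => ?_)
  have hfac : (φ y : ℂ) * character (-(s * y)) - φ y * character (-(t * y)) =
      φ y * character (-(t * y)) * (character ((t - s) * y) - 1) := by
    rw [mul_sub, mul_assoc, ← character_add]
    ring_nf
  have hle := norm_character_sub_one_le ((t - s) * y)
  rw [hfac, norm_mul, norm_mul, norm_character, mul_one, Complex.norm_real]
  calc ‖φ y‖ * ‖character ((t - s) * y) - 1‖
      ≤ ‖φ y‖ * (2 * Real.pi * |(t - s) * y|) := by gcongr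
    _ = _ := by rw [abs_mul, abs_sub_comm, Real.norm_eq_abs y]; ring

lemma norm_hatPhi_second_difference_le (φ : SchwartzMap ℝ ℝ) (t h : ℝ) :
    ‖(hatPhi φ (t - h) - hatPhi φ t) - (hatPhi φ t - hatPhi φ (t + h))‖ ≤
      (2 * Real.pi) ^ 2 * (∫ y : ℝ, ‖y‖ ^ 2 * ‖φ y‖) * |h| ^ 2 := by
  have hi := integrable_mul_character φ
  have hd (s u : ℝ) : Integrable fun y : ℝ =>
      (φ y : ℂ) * character (-(s * y)) - φ y * character (-(u * y)) := (hi s).sub (hi u)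
  simp only [hatPhi]
  rw [← integral_sub (hi _) (hi _), ← integral_sub (hi _) (hi _), ← integral_sub (hd _ _) (hd _ _),
    ← integral_const_mul, ← integral_mul_const]
  refine norm_integral_le_of_norm_le (((φ.integrable_pow_mul volume 2).const_mul _).mul_const _)
    (Filter.Eventually.of_forall fun y => ?_)
  have h₁ : character (-((t - h) * y)) = character (-((t + h) * y)) * character (h * y) ^ 2 := by
    rw [← character_natCast_mul, ← character_add]
    push_cast
    ring_nf
  have h₂ : character (-(t * y)) = character (-((t + h) * y)) * character (h * y) := by
    rw [← character_add]
    ring_nf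
  have hfac : (φ y * character (-((t - h) * y)) - φ y * character (-(t * y))) -
      (φ y * character (-(t * y)) - φ y * character (-((t + h) * y))) =
      φ y * character (-((t + h) * y)) * (character (h * y) - 1) ^ 2 := by
    rw [h₁, h₂]
    ring
  have hle := norm_character_sub_one_le (h * y)
  rw [hfac, norm_mul, norm_mul, norm_character, mul_one, Complex.norm_real, norm_pow]
  calc ‖φ y‖ * ‖character (h * y) - 1‖ ^ 2
      ≤ ‖φ y‖ * (2 * Real.pi * |h * y|) ^ 2 := by gcongr
    _ = _ := by rw [abs_mul, Real.norm_eq_abs y]; ring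

/-- `Q_N(D_N)` as a trigonometric polynomial, listed from the top frequency down. -/
lemma QDirichlet_eq_sum (φ : SchwartzMap ℝ ℝ) {N : ℕ} (hN : N ≠ 0) (x : ℝ) :
    (QDirichlet φ N x : ℂ) =
      character (N * x) * ∑ m ∈ Finset.range (2 * N + 1),
        hatPhi φ (1 - m / N) * character (-x) ^ m := by
  have hN' : (N : ℝ) ≠ 0 := by exact_mod_cast hN
  rw [QDirichlet, ← integral_complex_ofReal, Finset.mul_sum]
  simp only [Complex.ofReal_mul, dirichlet_eq_sum, Finset.mul_sum]
  have hterm (m : ℕ) (y : ℝ) : (φ y : ℂ) * character ((N - m) * (x - y / N)) =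
      φ y * character (-((1 - m / N) * y)) * character ((N - m) * x) := by
    rw [mul_assoc, ← character_add]
    congr 2
    field_simp
    ring
  simp only [hterm]
  rw [integral_finsetSum _ fun m _ => (integrable_mul_character φ _).mul_const _]
  refine Finset.sum_congr rfl fun m _ => ?_
  rw [integral_mul_const, ← character_natCast_mul, ← hatPhi, mul_left_comm, ← character_add]
  ring_nf

lemma norm_one_sub_mul_sum_le (c : ℕ → ℂ) {z : ℂ} (hz : ‖z‖ = 1) (n : ℕ) :
    ‖1 - z‖ * ‖∑ m ∈ Finset.range (n + 1), c m * z ^ m‖ ≤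
      ‖c 0‖ + ‖c n‖ + ‖∑ m ∈ Finset.range n, (c (m + 1) - c m) * z ^ m‖ := by
  have habel : (1 - z) * ∑ m ∈ Finset.range (n + 1), c m * z ^ m =
      c 0 - c n * z ^ (n + 1) + z * ∑ m ∈ Finset.range n, (c (m + 1) - c m) * z ^ m := by
    induction n with
    | zero => simp; ring
    | succ n ih =>
      rw [Finset.sum_range_succ, mul_add, ih, Finset.sum_range_succ _ n]
      ring
  rw [← norm_mul, habel]
  refine (norm_add_le _ _).trans (add_le_add ((norm_sub_le _ _).trans_eq ?_) ?_)
  · simp [hz]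
  · simp [hz]


lemma continuous_QDirichlet (φ : SchwartzMap ℝ ℝ) {N : ℕ} (hN : N ≠ 0) :
    Continuous (QDirichlet φ N) := by
  have hc : Continuous fun x => (QDirichlet φ N x : ℂ) := by
    simp only [QDirichlet_eq_sum φ hN]
    have := continuous_character
    fun_prop
  exact Complex.continuous_re.comp hc

lemma abs_QDirichlet_eq_norm_sum (φ : SchwartzMap ℝ ℝ) {N : ℕ} (hN : N ≠ 0) (x : ℝ) :
    |QDirichlet φ N x| =
      ‖∑ m ∈ Finset.range (2 * N + 1), hatPhi φ (1 - m / N) * character (-x) ^ m‖ := by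
  rw [← Real.norm_eq_abs, ← Complex.norm_real, QDirichlet_eq_sum φ hN, norm_mul, norm_character,
    one_mul]

lemma abs_QDirichlet_le_degree (φ : SchwartzMap ℝ ℝ) {N : ℕ} (hN : N ≠ 0) (x : ℝ) :
    |QDirichlet φ N x| ≤ 3 * N * ∫ y : ℝ, ‖φ y‖ := by
  have hN' : (1 : ℝ) ≤ N := by exact_mod_cast Nat.one_le_iff_ne_zero.mpr hN
  have h0 : 0 ≤ ∫ y : ℝ, ‖φ y‖ := integral_nonneg fun y => norm_nonneg _
  rw [abs_QDirichlet_eq_norm_sum φ hN]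
  calc _ ≤ ∑ m ∈ Finset.range (2 * N + 1), ∫ y : ℝ, ‖φ y‖ :=
        norm_sum_le_of_le _ fun m _ => by
          simpa [norm_character] using norm_hatPhi_le φ (1 - m / N)
    _ = (2 * N + 1) * ∫ y : ℝ, ‖φ y‖ := by simp
    _ ≤ _ := by gcongr; linarith

/-- Two summations by parts bound `Q_N(D_N)` away from the integers. -/
lemma exists_norm_sq_mul_abs_QDirichlet_le (φ : SchwartzMap ℝ ℝ) :
    ∃ C : ℝ, 0 ≤ C ∧ ∀ N : ℕ, N ≠ 0 → ∀ x : ℝ,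
      ‖1 - character (-x)‖ ^ 2 * |QDirichlet φ N x| ≤
        2 * ‖hatPhiOne φ‖ * ‖1 - character (-x)‖ + C / N := by
  set L := 2 * Real.pi * ∫ y : ℝ, ‖y‖ ^ 1 * ‖φ y‖ with hL
  set K := (2 * Real.pi) ^ 2 * ∫ y : ℝ, ‖y‖ ^ 2 * ‖φ y‖ with hK
  have hL0 : 0 ≤ L := mul_nonneg (by positivity) (integral_nonneg fun y => by positivity)
  have hK0 : 0 ≤ K := mul_nonneg (by positivity) (integral_nonneg fun y => by positivity)
  refine ⟨2 * L + 2 * K, by positivity, fun N hN x => ?_⟩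
  have hN' : (N : ℝ) ≠ 0 := by exact_mod_cast hN
  have hNpos : (0 : ℝ) < N := by positivity
  set c : ℕ → ℂ := fun m => hatPhi φ (1 - m / N) with hc
  have hz : ‖character (-x)‖ = 1 := norm_character _
  have hc₀ : ‖c 0‖ = ‖hatPhiOne φ‖ := by simp [hc, hatPhi_one]
  have hc₁ : ‖c (2 * N)‖ = ‖hatPhiOne φ‖ := by
    have : (1 - ((2 * N : ℕ) : ℝ) / N) = -1 := by
      push_cast
      field_simp
      norm_num
    simp only [hc]
    rw [this, hatPhi_neg, RCLike.norm_conj, hatPhi_one]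
  have hd₁ (m : ℕ) : ‖c (m + 1) - c m‖ ≤ L / N := by
    refine (norm_hatPhi_sub_le φ _ _).trans_eq ?_
    rw [show (1 - ((m + 1 : ℕ) : ℝ) / N) - (1 - m / N) = -(1 / N) by push_cast; ring, abs_neg,
      abs_of_pos (by positivity), ← hL]
    ring
  have hd₂ (m : ℕ) : ‖(c (m + 1 + 1) - c (m + 1)) - (c (m + 1) - c m)‖ ≤ K / N ^ 2 := by
    have := norm_hatPhi_second_difference_le φ (1 - (m + 1 : ℕ) / N) (1 / N)
    rw [abs_of_pos (by positivity), ← hK, one_div_pow, mul_one_div] at this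
    rwa [show 1 - ((m + 1 : ℕ) : ℝ) / N - 1 / N = 1 - ((m + 1 + 1 : ℕ) : ℝ) / N by
        push_cast; ring,
      show 1 - ((m + 1 : ℕ) : ℝ) / N + 1 / N = 1 - m / N by push_cast; ring] at this
  obtain ⟨n, hn⟩ : ∃ n, 2 * N = n + 1 := ⟨2 * N - 1, by omega⟩
  have h₁ := norm_one_sub_mul_sum_le c hz (2 * N)
  have h₂ := norm_one_sub_mul_sum_le (fun m => c (m + 1) - c m) hz n
  rw [← hn] at h₂
  have h₃ : ‖∑ m ∈ Finset.range n,
      ((c (m + 1 + 1) - c (m + 1)) - (c (m + 1) - c m)) * character (-x) ^ m‖ ≤ 2 * K / N := by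
    have hnN : (n : ℝ) ≤ 2 * N := by exact_mod_cast (by omega : n ≤ 2 * N)
    calc _ ≤ ∑ m ∈ Finset.range n, K / N ^ 2 :=
          norm_sum_le_of_le _ fun m _ => by simpa [hz] using hd₂ m
      _ = n * (K / N ^ 2) := by simp
      _ ≤ 2 * N * (K / N ^ 2) := by gcongr
      _ = 2 * K / N := by field_simp
  rw [hc₀, hc₁, ← abs_QDirichlet_eq_norm_sum φ hN] at h₁
  have h₄ := mul_le_mul_of_nonneg_left h₁ (norm_nonneg (1 - character (-x)))
  have h₅ : (2 * L + 2 * K) / N = L / N + L / N + 2 * K / N := by ring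
  have h₆ := hd₁ 0
  have h₇ := hd₁ n
  rw [← hn] at h₇
  rw [h₅]
  linarith

lemma inv_norm_one_sub_character_le {x : ℝ} (hx : x ∈ Set.Ioo (0 : ℝ) 1) :
    ‖1 - character (-x)‖⁻¹ ≤ (x⁻¹ + (1 - x)⁻¹) / 4 := by
  obtain ⟨h0, h1⟩ := hx
  have h1' : 0 < 1 - x := by linarith
  have hle : 2 * (x * (1 - x)) ≤ |Real.sin (Real.pi * x)| := by
    refine le_trans ?_ (le_abs_self _)
    have hpi := Real.pi_pos
    rcases le_total x (1 / 2) with h | h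
    · have := Real.mul_le_sin (x := Real.pi * x) (by positivity) (by nlinarith)
      rw [show 2 / Real.pi * (Real.pi * x) = 2 * x by field_simp] at this
      nlinarith
    · have := Real.mul_le_sin (x := Real.pi * (1 - x)) (by positivity) (by nlinarith)
      rw [show 2 / Real.pi * (Real.pi * (1 - x)) = 2 * (1 - x) by field_simp,
        show Real.pi * (1 - x) = Real.pi - Real.pi * x by ring, Real.sin_pi_sub] at this
      nlinarith
  have hpos : 0 < x * (1 - x) := by positivity
  rw [norm_sub_rev, norm_character_sub_one, mul_neg, Real.sin_neg, abs_neg]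
  calc (2 * |Real.sin (Real.pi * x)|)⁻¹ ≤ (2 * (2 * (x * (1 - x))))⁻¹ := by gcongr
    _ = (x⁻¹ + (1 - x)⁻¹) / 4 := by field_simp; ring

lemma exists_abs_QDirichlet_le (φ : SchwartzMap ℝ ℝ) :
    ∃ C : ℝ, 0 ≤ C ∧ ∀ N : ℕ, N ≠ 0 → ∀ x ∈ Set.Ioo (0 : ℝ) 1,
      |QDirichlet φ N x| ≤ ‖hatPhiOne φ‖ / 2 * (x⁻¹ + (1 - x)⁻¹) +
        C / N * (x ^ (-2 : ℤ) + (1 - x) ^ (-2 : ℤ)) := by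
  obtain ⟨C, hC, h⟩ := exists_norm_sq_mul_abs_QDirichlet_le φ
  refine ⟨C, hC, fun N hN x hx => ?_⟩
  have hinv := inv_norm_one_sub_character_le hx
  have hs : 0 < ‖1 - character (-x)‖ := by
    rw [norm_sub_rev, norm_character_sub_one, mul_neg, Real.sin_neg, abs_neg]
    have := Real.sin_pos_of_pos_of_lt_pi (mul_pos Real.pi_pos hx.1)
      (by nlinarith [Real.pi_pos, hx.2])
    positivity
  set s := ‖1 - character (-x)‖
  set u := x⁻¹
  set v := (1 - x)⁻¹
  have hsq : s⁻¹ ^ 2 ≤ u ^ 2 + v ^ 2 := by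
    have := pow_le_pow_left₀ (inv_nonneg.mpr hs.le) hinv 2
    nlinarith [sq_nonneg (u - v), sq_nonneg u, sq_nonneg v]
  calc |QDirichlet φ N x| = s⁻¹ ^ 2 * (s ^ 2 * |QDirichlet φ N x|) := by field_simp
    _ ≤ s⁻¹ ^ 2 * (2 * ‖hatPhiOne φ‖ * s + C / N) := by gcongr; exact h N hN x
    _ = 2 * ‖hatPhiOne φ‖ * s⁻¹ + C / N * s⁻¹ ^ 2 := by field_simp
    _ ≤ 2 * ‖hatPhiOne φ‖ * ((u + v) / 4) + C / N * (u ^ 2 + v ^ 2) := by gcongr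
    _ = _ := by
      rw [show x ^ (-2 : ℤ) = u ^ 2 by simp [u, zpow_neg],
        show (1 - x) ^ (-2 : ℤ) = v ^ 2 by simp [v, zpow_neg]]
      ring

lemma integral_Ico_eq (φ : SchwartzMap ℝ ℝ) (N : ℕ) :
    ∫ x in Set.Ico (0 : ℝ) 1, |QDirichlet φ N x| = ∫ x in (0 : ℝ)..1, |QDirichlet φ N x| := by
  rw [intervalIntegral.integral_of_le zero_le_one, integral_Ico_eq_integral_Ioc]

lemma exists_integral_abs_QDirichlet_le (φ : SchwartzMap ℝ ℝ) :
    ∃ C : ℝ, ∀ N : ℕ, 2 ≤ N →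
      ∫ x in Set.Ico (0 : ℝ) 1, |QDirichlet φ N x| ≤ ‖hatPhiOne φ‖ * Real.log N + C := by
  obtain ⟨C, hC, hbound⟩ := exists_abs_QDirichlet_le φ
  set M := ∫ y : ℝ, ‖φ y‖
  refine ⟨6 * M + 2 * C, fun N hN2 => ?_⟩
  have hN : N ≠ 0 := by omega
  have hN2' : (2 : ℝ) ≤ N := by exact_mod_cast hN2
  have hNpos : (0 : ℝ) < N := by linarith
  set δ : ℝ := 1 / N with hδ
  have hδ0 : 0 < δ := by positivity
  have hNδ : N * δ = 1 := by rw [hδ]; field_simp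
  have hδ2 : δ ≤ 1 - δ := by nlinarith
  have hδ1 : 0 < 1 - δ := by linarith
  have hcont : Continuous fun x => |QDirichlet φ N x| := (continuous_QDirichlet φ hN).abs
  have hend (a : ℝ) : ∫ x in a..(a + δ), |QDirichlet φ N x| ≤ 3 * M := by
    refine (intervalIntegral.integral_mono_on (by linarith) (hcont.intervalIntegrable _ _)
      intervalIntegrable_const fun x _ => abs_QDirichlet_le_degree φ hN x).trans_eq ?_
    rw [intervalIntegral.integral_const, smul_eq_mul]
    linear_combination (3 * M) * hNδ
  have hmem : (0 : ℝ) ∉ Set.uIcc δ (1 - δ) := by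
    rw [Set.uIcc_of_le hδ2]
    exact fun h => by linarith [h.1]
  have hi₁ : IntervalIntegrable (fun x : ℝ => x⁻¹) volume δ (1 - δ) :=
    intervalIntegrable_inv_iff.mpr (Or.inr hmem)
  have hi₂ : IntervalIntegrable (fun x : ℝ => x ^ (-2 : ℤ)) volume δ (1 - δ) :=
    intervalIntegral.intervalIntegrable_zpow (Or.inr hmem)
  have hi₁' : IntervalIntegrable (fun x : ℝ => (1 - x)⁻¹) volume δ (1 - δ) := by
    simpa using (hi₁.comp_sub_left 1).symm
  have hi₂' : IntervalIntegrable (fun x : ℝ => (1 - x) ^ (-2 : ℤ)) volume δ (1 - δ) := by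
    simpa using (hi₂.comp_sub_left 1).symm
  have hI₁ : ∫ x in δ..(1 - δ), x⁻¹ ≤ Real.log N := by
    rw [integral_inv_of_pos hδ0 hδ1]
    refine Real.log_le_log (by positivity) ?_
    rw [div_le_iff₀ hδ0]
    linarith
  have hI₂ : ∫ x in δ..(1 - δ), x ^ (-2 : ℤ) ≤ N := by
    rw [integral_zpow (Or.inr ⟨by norm_num, hmem⟩)]
    have h₁ : δ ^ (-2 + 1 : ℤ) = N := by norm_num [hδ]
    have h₂ : 0 ≤ (1 - δ) ^ (-2 + 1 : ℤ) := by positivity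
    rw [h₁, Int.cast_neg, Int.cast_ofNat, show (-2 + 1 : ℝ) = -1 by norm_num, div_neg, div_one]
    linarith
  have hI₁' : ∫ x in δ..(1 - δ), (1 - x)⁻¹ ≤ Real.log N := by
    rw [intervalIntegral.integral_comp_sub_left (fun x : ℝ => x⁻¹) 1]
    simpa using hI₁
  have hI₂' : ∫ x in δ..(1 - δ), (1 - x) ^ (-2 : ℤ) ≤ N := by
    rw [intervalIntegral.integral_comp_sub_left (fun x : ℝ => x ^ (-2 : ℤ)) 1, sub_sub_cancel]
    exact hI₂
  have hmid : ∫ x in δ..(1 - δ), |QDirichlet φ N x| ≤ ‖hatPhiOne φ‖ * Real.log N + 2 * C := by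
    calc ∫ x in δ..(1 - δ), |QDirichlet φ N x|
        ≤ ∫ x in δ..(1 - δ), (‖hatPhiOne φ‖ / 2 * (x⁻¹ + (1 - x)⁻¹) +
            C / N * (x ^ (-2 : ℤ) + (1 - x) ^ (-2 : ℤ))) := by
          refine intervalIntegral.integral_mono_on hδ2 (hcont.intervalIntegrable _ _)
            (((hi₁.add hi₁').const_mul _).add ((hi₂.add hi₂').const_mul _)) fun x hx => ?_
          exact hbound N hN x ⟨by linarith [hx.1], by linarith [hx.2]⟩
      _ = ‖hatPhiOne φ‖ / 2 * ((∫ x in δ..(1 - δ), x⁻¹) + ∫ x in δ..(1 - δ), (1 - x)⁻¹) +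
            C / N * ((∫ x in δ..(1 - δ), x ^ (-2 : ℤ)) +
              ∫ x in δ..(1 - δ), (1 - x) ^ (-2 : ℤ)) := by
          rw [intervalIntegral.integral_add ((hi₁.add hi₁').const_mul _)
              ((hi₂.add hi₂').const_mul _),
            intervalIntegral.integral_const_mul, intervalIntegral.integral_const_mul,
            intervalIntegral.integral_add hi₁ hi₁', intervalIntegral.integral_add hi₂ hi₂']
      _ ≤ ‖hatPhiOne φ‖ / 2 * (Real.log N + Real.log N) + C / N * (N + N) := by gcongr
      _ = _ := by field_simp; ring
  have hint (a b : ℝ) := hcont.intervalIntegrable (μ := volume) a b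
  rw [integral_Ico_eq, ← intervalIntegral.integral_add_adjacent_intervals (hint 0 δ) (hint δ 1),
    ← intervalIntegral.integral_add_adjacent_intervals (hint δ (1 - δ)) (hint (1 - δ) 1)]
  have h₁ := hend 0
  have h₂ := hend (1 - δ)
  rw [zero_add] at h₁
  rw [sub_add_cancel] at h₂
  linarith

/-- The Fourier coefficients of the sawtooth function; the one at `m = 0` vanishes. -/
lemma integral_sawtooth_mul_character (m : ℕ) :
    ∫ x in (0 : ℝ)..1, ((1 / 2 - x : ℝ) : ℂ) * character (-x) ^ m =
      1 / (2 * Real.pi * Complex.I * m) := by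
  rcases eq_or_ne m 0 with rfl | hm
  · simp only [pow_zero, mul_one, Nat.cast_zero, mul_zero, div_zero]
    rw [intervalIntegral.integral_ofReal, intervalIntegral.integral_sub (by simp) (by simp)]
    simp
  set w : ℂ := -(2 * Real.pi * Complex.I * m) with hw
  have hw0 : w ≠ 0 := by
    simp [hw, Real.pi_ne_zero, hm]
  have hpow (x : ℝ) : character (-x) ^ m = Complex.exp (w * x) := by
    rw [character, ← Complex.exp_nat_mul, hw]
    push_cast
    ring_nf
  have hderiv (x : ℝ) : HasDerivAt
      (fun x : ℝ => (1 / 2 - x : ℂ) * Complex.exp (w * x) / w + Complex.exp (w * x) / w ^ 2)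
      (((1 / 2 - x : ℝ) : ℂ) * character (-x) ^ m) x := by
    have hlin : HasDerivAt (fun x : ℝ => (1 / 2 - x : ℂ)) (-1) x := by
      simpa using (Complex.ofRealCLM.hasDerivAt (x := x)).const_sub (1 / 2 : ℂ)
    have hexp : HasDerivAt (fun x : ℝ => Complex.exp (w * x)) (Complex.exp (w * x) * w) x := by
      simpa using ((Complex.ofRealCLM.hasDerivAt (x := x)).const_mul w).cexp
    refine (((hlin.mul hexp).div_const w).add (hexp.div_const (w ^ 2))).congr_deriv ?_
    rw [hpow]
    push_cast
    field_simp
    ring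
  have hcont : Continuous fun x : ℝ => ((1 / 2 - x : ℝ) : ℂ) * character (-x) ^ m := by
    have := continuous_character
    fun_prop
  rw [intervalIntegral.integral_eq_sub_of_hasDerivAt (fun x _ => hderiv x)
    (hcont.intervalIntegrable _ _)]
  have hexp1 : Complex.exp (w * (1 : ℝ)) = 1 := by
    rw [← hpow, ← character_natCast_mul, mul_neg_one, character_neg_natCast]
  have hden : (2 * Real.pi * Complex.I * m : ℂ) = -w := by rw [hw, neg_neg]
  rw [hexp1, hden]
  simp
  field_simp
  ring

lemma exists_le_integral_abs_QDirichlet (φ : SchwartzMap ℝ ℝ) :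
    ∃ C : ℝ, ∀ N : ℕ, N ≠ 0 → ‖hatPhiOne φ‖ * Real.log N - C ≤
      Real.pi * ∫ x in Set.Ico (0 : ℝ) 1, |QDirichlet φ N x| := by
  set L := 2 * Real.pi * ∫ y : ℝ, ‖y‖ ^ 1 * ‖φ y‖ with hL
  have hL0 : 0 ≤ L := mul_nonneg (by positivity) (integral_nonneg fun y => by positivity)
  refine ⟨3 * L, fun N hN => ?_⟩
  have hNpos : (0 : ℝ) < N := by positivity
  have hN1 : (1 : ℝ) ≤ N := by exact_mod_cast Nat.one_le_iff_ne_zero.mpr hN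
  set c : ℕ → ℂ := fun m => hatPhi φ (1 - m / N) with hc
  have hpair : ∫ x in (0 : ℝ)..1,
      (QDirichlet φ N x : ℂ) * (character (-(N * x)) * ((1 / 2 - x : ℝ) : ℂ)) =
      1 / (2 * Real.pi * Complex.I) * ∑ m ∈ Finset.range (2 * N + 1), c m / m := by
    have hpt (x : ℝ) : (QDirichlet φ N x : ℂ) * (character (-(N * x)) * ((1 / 2 - x : ℝ) : ℂ)) =
        ∑ m ∈ Finset.range (2 * N + 1), c m * (((1 / 2 - x : ℝ) : ℂ) * character (-x) ^ m) := by
      have hone : character (N * x) * character (-(N * x)) = 1 := by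
        rw [← character_add, add_neg_cancel, character_zero]
      simp_rw [mul_left_comm (c _), ← Finset.mul_sum]
      rw [QDirichlet_eq_sum φ hN]
      linear_combination (((1 / 2 - x : ℝ) : ℂ) *
        ∑ m ∈ Finset.range (2 * N + 1), c m * character (-x) ^ m) * hone
    simp_rw [hpt]
    rw [intervalIntegral.integral_finsetSum, Finset.mul_sum]
    · refine Finset.sum_congr rfl fun m _ => ?_
      rw [intervalIntegral.integral_const_mul, integral_sawtooth_mul_character]
      ring
    · intro m _
      have := continuous_character
      exact Continuous.intervalIntegrable (by fun_prop) _ _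
  have hupper : ‖∫ x in (0 : ℝ)..1,
      (QDirichlet φ N x : ℂ) * (character (-(N * x)) * ((1 / 2 - x : ℝ) : ℂ))‖ ≤
      (∫ x in (0 : ℝ)..1, |QDirichlet φ N x|) * (1 / 2) := by
    rw [← intervalIntegral.integral_mul_const]
    refine intervalIntegral.norm_integral_le_of_norm_le zero_le_one
      (Filter.Eventually.of_forall fun x hx => ?_)
      (((continuous_QDirichlet φ hN).abs.mul continuous_const).intervalIntegrable _ _)
    rw [norm_mul, norm_mul, norm_character, one_mul, Complex.norm_real, Complex.norm_real,
      Real.norm_eq_abs, Real.norm_eq_abs]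
    gcongr
    rw [abs_le]
    constructor <;> linarith [hx.1, hx.2]
  have hharm : Real.log N ≤ ∑ m ∈ Finset.range (2 * N + 1), (m : ℝ)⁻¹ := by
    have h := log_add_one_le_harmonic (2 * N)
    rw [harmonic] at h
    rw [Finset.sum_range_succ']
    push_cast at h ⊢
    rw [inv_zero, add_zero]
    exact (Real.log_le_log hNpos (by linarith)).trans h
  have herr : ‖∑ m ∈ Finset.range (2 * N + 1), (c m - hatPhiOne φ) / m‖ ≤ 3 * L := by
    calc _ ≤ ∑ m ∈ Finset.range (2 * N + 1), L / N := by
          refine norm_sum_le_of_le _ fun m _ => ?_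
          rcases eq_or_ne m 0 with rfl | hm
          · simp
            positivity
          have hmpos : (0 : ℝ) < m := by positivity
          rw [norm_div, Complex.norm_natCast, div_le_iff₀ hmpos, ← hatPhi_one]
          refine (norm_hatPhi_sub_le φ _ _).trans_eq ?_
          rw [sub_sub_cancel_left, abs_neg, abs_of_pos (by positivity), ← hL]
          ring
      _ = (2 * N + 1) * (L / N) := by simp
      _ ≤ (3 * N) * (L / N) := by gcongr; linarith
      _ = 3 * L := by field_simp
  have hsum : hatPhiOne φ * ((∑ m ∈ Finset.range (2 * N + 1), (m : ℝ)⁻¹ : ℝ) : ℂ) =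
      (∑ m ∈ Finset.range (2 * N + 1), c m / m) -
        ∑ m ∈ Finset.range (2 * N + 1), (c m - hatPhiOne φ) / m := by
    rw [← Finset.sum_sub_distrib]
    push_cast
    rw [Finset.mul_sum]
    refine Finset.sum_congr rfl fun m _ => ?_
    ring
  have hmain : ‖hatPhiOne φ‖ * Real.log N ≤
      ‖∑ m ∈ Finset.range (2 * N + 1), c m / m‖ + 3 * L := by
    calc ‖hatPhiOne φ‖ * Real.log N
        ≤ ‖hatPhiOne φ‖ * ∑ m ∈ Finset.range (2 * N + 1), (m : ℝ)⁻¹ := by gcongr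
      _ = ‖hatPhiOne φ * ((∑ m ∈ Finset.range (2 * N + 1), (m : ℝ)⁻¹ : ℝ) : ℂ)‖ := by
          rw [norm_mul, Complex.norm_real, Real.norm_of_nonneg (Finset.sum_nonneg fun m _ => by
            positivity)]
      _ ≤ _ := by
          rw [hsum]
          exact (norm_sub_le _ _).trans (by gcongr)
  have hnorm : ‖(1 / (2 * Real.pi * Complex.I) : ℂ)‖ = 1 / (2 * Real.pi) := by
    simp [abs_of_pos Real.pi_pos]
  rw [hpair, norm_mul, hnorm] at hupper
  rw [integral_Ico_eq]
  have hpi := Real.pi_pos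
  have hscaled := mul_le_mul_of_nonneg_left hupper (by positivity : 0 ≤ 2 * Real.pi)
  rw [← mul_assoc, mul_one_div_cancel (by positivity), one_mul] at hscaled
  linarith

/-- (i) If `φ̂(1) = 0` then `‖Q_N(D_N)‖_{L¹(𝕋)}/log N → 0`.
(ii) If `φ̂(1) ≠ 0` then there are `N₀ = N₀(φ)` and absolute constants `c₁, c₂ > 0` with
`c₁|φ̂(1)| log N ≤ ‖Q_N(D_N)‖_{L¹(𝕋)} ≤ c₂|φ̂(1)| log N` for all `N ≥ N₀`. -/
theorem statement14 :
    ∃ c₁ c₂ : ℝ, 0 < c₁ ∧ 0 < c₂ ∧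
      ∀ φ : SchwartzMap ℝ ℝ,
        (hatPhiOne φ = 0 →
          Filter.Tendsto
            (fun N : ℕ => (∫ x in Set.Ico (0 : ℝ) 1, |QDirichlet φ N x|) / Real.log N)
            Filter.atTop (nhds 0)) ∧
        (hatPhiOne φ ≠ 0 →
          ∃ N₀ : ℕ, ∀ N : ℕ, N₀ ≤ N →
            c₁ * ‖hatPhiOne φ‖ * Real.log N
                ≤ ∫ x in Set.Ico (0 : ℝ) 1, |QDirichlet φ N x| ∧
            (∫ x in Set.Ico (0 : ℝ) 1, |QDirichlet φ N x|)
                ≤ c₂ * ‖hatPhiOne φ‖ * Real.log N) := by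
  have hlog : Filter.Tendsto (fun N : ℕ => Real.log N) Filter.atTop Filter.atTop :=
    Real.tendsto_log_atTop.comp tendsto_natCast_atTop_atTop
  have hpi := Real.pi_pos
  refine ⟨1 / (2 * Real.pi), 2, by positivity, by norm_num, fun φ => ?_⟩
  obtain ⟨C, hupper⟩ := exists_integral_abs_QDirichlet_le φ
  obtain ⟨D, hlower⟩ := exists_le_integral_abs_QDirichlet φ
  refine ⟨fun h0 => ?_, fun h0 => ?_⟩
  · refine tendsto_of_tendsto_of_tendsto_of_le_of_le' tendsto_const_nhds (hlog.const_div_atTop C)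
      (Filter.Eventually.of_forall fun N => ?_) ?_
    · exact div_nonneg (integral_nonneg fun x => abs_nonneg _) (Real.log_natCast_nonneg N)
    · filter_upwards [Filter.eventually_ge_atTop 2] with N hN
      have := hupper N hN
      rw [h0, norm_zero, zero_mul, zero_add] at this
      exact div_le_div_of_nonneg_right this (Real.log_natCast_nonneg N)
  · have hA : 0 < ‖hatPhiOne φ‖ := norm_pos_iff.mpr h0
    have hlarge (B : ℝ) : ∀ᶠ N : ℕ in Filter.atTop, B ≤ ‖hatPhiOne φ‖ * Real.log N :=
      (hlog.const_mul_atTop hA).eventually_ge_atTop B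
    obtain ⟨N₀, hN₀⟩ := Filter.eventually_atTop.mp
      ((hlarge C).and ((hlarge (2 * D)).and (Filter.eventually_ge_atTop 2)))
    refine ⟨N₀, fun N hN => ?_⟩
    obtain ⟨hC, hD, hN2⟩ := hN₀ N hN
    have hu := hupper N hN2
    have hl := hlower N (by omega)
    constructor
    · rw [mul_assoc, one_div_mul_eq_div, div_le_iff₀ (by positivity)]
      linarith
    · linarith

end
end

section
/- Fix ν > 0 and 0 < τ_* ≤ 1/2. There exist an absolute constant β > 0 and an integer N₀ depending only on (τ_*, ν) such that the following holds. Let τ_* ≤ τ ≤ 1/2, let N ≥ N₀ be an integer, let 0 ≤ α₀ ≤ 1, and let u⁰ be a real-valued trigonometric polynomial on 𝕋 of degree at most N with ‖u⁰‖_∞ ≤ 1 + α₀. Define recursively u^{n+1}(x) = ∑_{k ∈ ℤ, |k| ≤ N} (1 + 4π²ν²τk²)^{-1} ĝ_n(k) e^{2πikx}, where g_n = (1+τ)u^n − τ(u^n)³. Then, with θ = 1 − 2τ, for every n ≥ 1: ‖u^n‖_∞ ≤ 1 + θⁿ α₀ + (β/(ν²N²)) log(N+2) · (1 − θⁿ)/(1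 − θ). -/
open MeasureTheory

noncomputable section

/-- One implicit-explicit Fourier Galerkin step for Allen–Cahn:
`u^{n+1} = (Id − τν²∂ₓₓ)⁻¹ Π_N ((1+τ)uⁿ − τ(uⁿ)³)`, written out via Fourier coefficients
of `gₙ = (1+τ)uⁿ − τ(uⁿ)³`. -/
def imexStep (ν τ : ℝ) (N : ℕ) (u : ℝ → ℝ) (x : ℝ) : ℂ :=
  ∑ k ∈ Finset.Icc (-(N : ℤ)) (N : ℤ),
    (((1 + 4 * Real.pi ^ 2 * ν ^ 2 * τ * (k : ℝ) ^ 2)⁻¹ : ℝ) : ℂ) *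
      (∫ y in Set.Ico (0 : ℝ) 1,
        (((1 + τ) * u y - τ * (u y) ^ 3 : ℝ) : ℂ) * e1 (-(k : ℝ) * y)) *
      e1 ((k : ℝ) * x)

theorem e1_add (s t : ℝ) : e1 (s + t) = e1 s * e1 t := by
  simp only [e1, ← Complex.exp_add]
  congr 1
  push_cast
  ring

theorem e1_intCast (k : ℤ) : e1 k = 1 := by
  rw [e1, Complex.exp_eq_one_iff]
  exact ⟨k, by push_cast; ring⟩

theorem e1_add_e1_neg (t : ℝ) : e1 t + e1 (-t) = ((2 * Real.cos (2 * Real.pi * t) : ℝ) : ℂ) := by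
  simp only [e1]
  push_cast
  rw [Complex.two_cos]
  congr 2 <;> ring

theorem hasDerivAt_e1_mul (k x : ℝ) :
    HasDerivAt (fun y : ℝ => e1 (k * y)) (2 * Real.pi * Complex.I * k * e1 (k * x)) x := by
  have h : HasDerivAt (fun y : ℝ => 2 * Real.pi * Complex.I * ((k * y : ℝ) : ℂ))
      (2 * Real.pi * Complex.I * ((k * 1 : ℝ) : ℂ)) x :=
    (((hasDerivAt_id x).const_mul k).ofReal_comp).const_mul _
  refine h.cexp.congr_deriv ?_
  rw [e1, mul_one]
  ring

@[fun_prop]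
theorem continuous_e1 : Continuous e1 := by
  unfold e1
  fun_prop

theorem integral_e1 (k : ℤ) : ∫ y in (0 : ℝ)..1, e1 (k * y) = if k = 0 then 1 else 0 := by
  split_ifs with hk
  · simp [hk, e1]
  · have hc : (2 * Real.pi * Complex.I * ((k : ℝ) : ℂ)) ≠ 0 := by
      simp [Real.pi_ne_zero, hk]
    have h := intervalIntegral.integral_eq_sub_of_hasDerivAt (a := 0) (b := 1)
      (fun x _ => hasDerivAt_e1_mul (k : ℝ) x)
      (Continuous.intervalIntegrable (by fun_prop) _ _)
    rw [intervalIntegral.integral_const_mul, mul_one, mul_zero, e1_intCast,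
      show e1 0 = 1 by simp [e1], sub_self] at h
    exact (mul_eq_zero.mp h).resolve_left hc

/-- The `k`-th Fourier coefficient over one period. -/
def coef (f : ℝ → ℂ) (k : ℤ) : ℂ := ∫ y in (0 : ℝ)..1, f y * e1 (-(k : ℝ) * y)

/-- Trigonometric polynomials of degree at most `M`. -/
def trigPoly (M : ℕ) : Submodule ℂ (ℝ → ℂ) :=
  Submodule.span ℂ ((fun (k : ℤ) (x : ℝ) => e1 (k * x)) '' Set.Icc (-(M : ℤ)) M)

theorem trigPoly_mono {M L : ℕ} (h : M ≤ L) : trigPoly M ≤ trigPoly L :=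
  Submodule.span_mono (Set.image_mono (Set.Icc_subset_Icc (by omega) (by omega)))

theorem sum_mem_trigPoly (M : ℕ) (a : ℤ → ℂ) :
    (fun x : ℝ => ∑ k ∈ Finset.Icc (-(M : ℤ)) M, a k * e1 ((k : ℝ) * x)) ∈ trigPoly M := by
  have : (fun x : ℝ => ∑ k ∈ Finset.Icc (-(M : ℤ)) M, a k * e1 ((k : ℝ) * x))
      = ∑ k ∈ Finset.Icc (-(M : ℤ)) M, a k • (fun x : ℝ => e1 ((k : ℝ) * x)) := by
    ext x
    simp
  rw [this]
  refine Submodule.sum_mem _ fun k hk => Submodule.smul_mem _ _ (Submodule.subset_span ?_)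
  exact ⟨k, by simpa using hk, rfl⟩

theorem mul_mem_trigPoly {M L : ℕ} {f g : ℝ → ℂ} (hf : f ∈ trigPoly M) (hg : g ∈ trigPoly L) :
    f * g ∈ trigPoly (M + L) := by
  have h := Submodule.mul_mem_mul hf hg
  rw [trigPoly, trigPoly, Submodule.span_mul_span] at h
  refine Submodule.span_mono ?_ h
  rintro _ ⟨_, ⟨k, hk, rfl⟩, _, ⟨l, hl, rfl⟩, rfl⟩
  refine ⟨k + l, ?_, ?_⟩
  · simp only [Set.mem_Icc] at hk hl ⊢
    push_cast
    omega
  · ext x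
    simp only [Pi.mul_apply, ← e1_add]
    congr 1
    push_cast
    ring

theorem continuous_of_mem_trigPoly {M : ℕ} {f : ℝ → ℂ} (hf : f ∈ trigPoly M) : Continuous f := by
  induction hf using Submodule.span_induction with
  | mem f h =>
    obtain ⟨k, -, rfl⟩ := h
    fun_prop
  | zero => exact continuous_zero
  | add f g _ _ hf hg => exact hf.add hg
  | smul a f _ hf => exact hf.const_smul a

theorem coef_add {f g : ℝ → ℂ} (hf : Continuous f) (hg : Continuous g) (k : ℤ) :
    coef (f + g) k = coef f k + coef g k := by
  simp only [coef, Pi.add_apply, add_mul]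
  exact intervalIntegral.integral_add (Continuous.intervalIntegrable (by fun_prop) _ _)
    (Continuous.intervalIntegrable (by fun_prop) _ _)

theorem coef_smul (a : ℂ) (f : ℝ → ℂ) (k : ℤ) : coef (a • f) k = a * coef f k := by
  simp only [coef, Pi.smul_apply, smul_eq_mul, mul_assoc]
  exact intervalIntegral.integral_const_mul _ _

theorem coef_e1 (l k : ℤ) : coef (fun x => e1 (l * x)) k = if l = k then 1 else 0 := by
  simp only [coef, ← e1_add]
  have h := integral_e1 (l - k)
  simp only [sub_eq_zero] at h
  rw [← h]
  congr 1
  ext y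
  congr 1
  push_cast
  ring

theorem coef_eq_zero_of_mem_trigPoly {M : ℕ} {f : ℝ → ℂ} (hf : f ∈ trigPoly M) {k : ℤ}
    (hk : k ∉ Set.Icc (-(M : ℤ)) M) : coef f k = 0 := by
  induction hf using Submodule.span_induction with
  | mem f h =>
    obtain ⟨l, hl, rfl⟩ := h
    rw [coef_e1, if_neg]
    rintro rfl
    exact hk hl
  | zero => simp [coef]
  | add f g hf hg ihf ihg =>
    rw [coef_add (continuous_of_mem_trigPoly hf) (continuous_of_mem_trigPoly hg), ihf, ihg,
      add_zero]
  | smul a f _ hf => rw [coef_smul, hf, mul_zero]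

theorem eq_sum_coef_of_mem_trigPoly {M : ℕ} {f : ℝ → ℂ} (hf : f ∈ trigPoly M) (x : ℝ) :
    ∑ k ∈ Finset.Icc (-(M : ℤ)) M, coef f k * e1 (k * x) = f x := by
  induction hf using Submodule.span_induction with
  | mem f h =>
    obtain ⟨l, hl, rfl⟩ := h
    simp [coef_e1, hl.1, hl.2]
  | zero => simp [coef]
  | add f g hf hg ihf ihg =>
    simp only [coef_add (continuous_of_mem_trigPoly hf) (continuous_of_mem_trigPoly hg), add_mul,
      Finset.sum_add_distrib, ihf, ihg, Pi.add_apply]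
  | smul a f _ hf =>
    simp only [coef_smul, mul_assoc, ← Finset.mul_sum, hf, Pi.smul_apply, smul_eq_mul]

/-- Maximum principle for the first-order operator `1 + s ∂ₓ` on periodic functions. -/
theorem norm_le_of_norm_add_smul_deriv_le {w w' : ℝ → ℂ} (hw : ∀ x, HasDerivAt w (w' x) x)
    (hper : Function.Periodic w 1) {s B : ℝ} (hB : ∀ x, ‖w x + s * w' x‖ ≤ B) (x : ℝ) :
    ‖w x‖ ≤ B := by
  have hcont : Continuous w := continuous_iff_continuousAt.2 fun x => (hw x).continuousAt
  obtain ⟨x₀, -, hx₀⟩ := isCompact_Icc.exists_isMaxOn (Set.nonempty_Icc.2 (zero_le_one' ℝ))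
    (hcont.norm.continuousOn)
  have hmax : ∀ y, ‖w y‖ ≤ ‖w x₀‖ := by
    intro y
    obtain ⟨z, hz, hyz⟩ := hper.exists_mem_Ico₀ one_pos y
    rw [hyz]
    exact hx₀ (Set.Ico_subset_Icc_self hz)
  have hderiv : 2 * inner ℝ (w x₀) (w' x₀) = 0 := by
    refine IsLocalMax.hasDerivAt_eq_zero (f := fun y => ‖w y‖ ^ 2) ?_ (hw x₀).norm_sq
    exact Filter.Eventually.of_forall fun y => by
      simpa using pow_le_pow_left₀ (norm_nonneg _) (hmax y) 2
  have hsq : ‖w x₀‖ ^ 2 ≤ ‖w x₀ + s * w' x₀‖ ^ 2 := by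
    have h := norm_add_sq_real (w x₀) (s • w' x₀)
    rw [inner_smul_right, Complex.real_smul] at h
    rw [h, (mul_eq_zero.1 hderiv).resolve_left two_ne_zero]
    nlinarith [sq_nonneg ‖(s : ℂ) * w' x₀‖]
  exact (hmax x).trans ((abs_le_of_sq_le_sq' hsq (norm_nonneg _)).2.trans (hB x₀))

theorem norm_sum_e1_le (M : ℕ) (d : ℤ → ℂ) {b B : ℝ}
    (hB : ∀ x : ℝ, ‖∑ k ∈ Finset.Icc (-(M : ℤ)) M, (1 + Complex.I * b * k) * d k * e1 (k * x)‖ ≤ B)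
    (x : ℝ) : ‖∑ k ∈ Finset.Icc (-(M : ℤ)) M, d k * e1 (k * x)‖ ≤ B := by
  refine norm_le_of_norm_add_smul_deriv_le (s := b / (2 * Real.pi))
    (w := fun x => ∑ k ∈ Finset.Icc (-(M : ℤ)) M, d k * e1 (k * x))
    (fun x => HasDerivAt.fun_sum fun k _ => (hasDerivAt_e1_mul k x).const_mul (d k)) ?_ ?_ x
  · intro x
    refine Finset.sum_congr rfl fun k _ => ?_
    rw [mul_add, mul_one, e1_add, e1_intCast, mul_one]
  · intro x
    convert hB x using 2
    rw [Finset.mul_sum, ← Finset.sum_add_distrib]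
    refine Finset.sum_congr rfl fun k _ => ?_
    have : (Real.pi : ℂ) ≠ 0 := by simp [Real.pi_ne_zero]
    push_cast
    field_simp

/-- The resolvent of the Laplacian is a contraction in the supremum norm. -/
theorem norm_resolvent_le {M : ℕ} {f : ℝ → ℂ} (hf : f ∈ trigPoly M) {a B : ℝ} (ha : 0 ≤ a)
    (hB : ∀ x, ‖f x‖ ≤ B) (x : ℝ) :
    ‖∑ k ∈ Finset.Icc (-(M : ℤ)) M,
      (((1 + a * (k : ℝ) ^ 2)⁻¹ : ℝ) : ℂ) * coef f k * e1 (k * x)‖ ≤ B := by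
  refine norm_sum_e1_le M _ (b := √a) (fun x => ?_) x
  simp only [mul_assoc]
  simp only [← mul_assoc (1 + Complex.I * _) (Complex.ofReal _)]
  simp only [← mul_assoc _ (coef f _)]
  refine norm_sum_e1_le M _ (b := -√a) (fun x => ?_) x
  convert hB x using 2
  rw [← eq_sum_coef_of_mem_trigPoly hf x]
  refine Finset.sum_congr rfl fun k _ => ?_
  have h1 : (1 + a * (k : ℝ) ^ 2 : ℝ) ≠ 0 := by positivity
  have h2 : (1 + Complex.I * ((-√a : ℝ) : ℂ) * k) * (1 + Complex.I * (√a * k))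
      = ((1 + a * (k : ℝ) ^ 2 : ℝ) : ℂ) := by
    have hs : ((√a : ℝ) : ℂ) ^ 2 = a := by
      rw [← Complex.ofReal_pow, Real.sq_sqrt ha]
    push_cast
    linear_combination (-(√a : ℂ) ^ 2 * k ^ 2) * Complex.I_sq + (k : ℂ) ^ 2 * hs
  rw [← mul_assoc, ← mul_assoc, h2, ← Complex.ofReal_mul, mul_inv_cancel₀ h1, Complex.ofReal_one,
    one_mul]

theorem abs_sum_mul_sub_le {c s : ℕ → ℝ} (hc : Antitone c) (hc0 : ∀ k, 0 ≤ c k)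
    (hs : ∀ k, |s k| ≤ 1) {N M : ℕ} (hNM : N ≤ M) :
    |∑ k ∈ Finset.Ioc N M, c k * (s k - s (k - 1))| ≤ 2 * c N := by
  have key : |∑ k ∈ Finset.Ioc N M, c k * (s k - s (k - 1)) - c M * s M| ≤ 2 * c N - c M := by
    induction M, hNM using Nat.le_induction with
    | base =>
      have h1 := hc0 N
      have h2 := abs_le.1 (hs N)
      rw [Finset.Ioc_self, Finset.sum_empty, abs_le]
      constructor <;> nlinarith
    | succ M h ih =>
      rw [← Finset.insert_Ioc_right_eq_Ioc_add_one (by omega), Finset.sum_insert (by simp),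
        Nat.add_sub_cancel]
      have h1 : c (M + 1) ≤ c M := hc (Nat.le_succ M)
      have h2 := abs_le.1 (hs M)
      rw [abs_le] at ih ⊢
      constructor <;> nlinarith
  have h1 := abs_le.1 (hs M)
  have h2 := hc0 M
  rw [abs_le] at key ⊢
  constructor <;> nlinarith

/-- The kernel with cosine coefficients `c k` for `N < k ≤ M`. -/
def tailKernel (c : ℕ → ℝ) (N M : ℕ) (t : ℝ) : ℝ :=
  ∑ k ∈ Finset.Ioc N M, c k * (2 * Real.cos (2 * Real.pi * (k * t)))

@[fun_prop]
theorem continuous_tailKernel (c : ℕ → ℝ) (N M : ℕ) : Continuous (tailKernel c N M) := by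
  unfold tailKernel
  fun_prop

theorem tailKernel_periodic (c : ℕ → ℝ) (N M : ℕ) :
    Function.Periodic (tailKernel c N M) 1 := by
  intro t
  refine Finset.sum_congr rfl fun k _ => ?_
  rw [show 2 * Real.pi * (k * (t + 1)) = 2 * Real.pi * (k * t) + k * (2 * Real.pi) by ring,
    Real.cos_add_nat_mul_two_pi]

theorem abs_tailKernel_mul_sin_le {c : ℕ → ℝ} (hc : Antitone c) (hc0 : ∀ k, 0 ≤ c k) {N M : ℕ}
    (hNM : N ≤ M) (t : ℝ) : |tailKernel c N M t * Real.sin (Real.pi * t)| ≤ 2 * c N := by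
  convert abs_sum_mul_sub_le hc hc0
    (s := fun k => Real.sin ((2 * k + 1) * (Real.pi * t))) (fun k => Real.abs_sin_le_one _) hNM
    using 2
  rw [tailKernel, Finset.sum_mul]
  refine Finset.sum_congr rfl fun k hk => ?_
  have hk1 : 1 ≤ k := by
    have := (Finset.mem_Ioc.1 hk).1
    omega
  rw [Real.sin_sub_sin, Nat.cast_sub hk1, mul_assoc]
  congr 1
  rw [show ((2 * k + 1) * (Real.pi * t) - (2 * (k - (1 : ℕ)) + 1) * (Real.pi * t)) / 2
      = Real.pi * t by push_cast; ring,
    show ((2 * k + 1) * (Real.pi * t) + (2 * (k - (1 : ℕ)) + 1) * (Real.pi * t)) / 2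
      = 2 * Real.pi * (k * t) by push_cast; ring]
  ring

theorem abs_tailKernel_le {c : ℕ → ℝ} (hc : Antitone c) (hc0 : ∀ k, 0 ≤ c k) (N M : ℕ) (t : ℝ) :
    |tailKernel c N M t| ≤ (M - N : ℕ) * (2 * c N) := by
  refine (Finset.abs_sum_le_sum_abs _ _).trans ?_
  rw [← Nat.card_Ioc, ← nsmul_eq_mul]
  refine Finset.sum_le_card_nsmul _ _ _ fun k hk => ?_
  have h1 := hc (Finset.mem_Ioc.1 hk).1.le
  have h2 := Real.abs_cos_le_one (2 * Real.pi * (k * t))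
  rw [abs_mul, abs_mul, abs_of_nonneg (hc0 k), abs_two]
  nlinarith [hc0 k]

theorem abs_tailKernel_mul_le_of_le_half {c : ℕ → ℝ} (hc : Antitone c) (hc0 : ∀ k, 0 ≤ c k)
    {N : ℕ} (hN : 1 ≤ N) {t y : ℝ} (hy : 0 ≤ y) (hy' : y ≤ 1 / 2)
    (hty : Real.sin (Real.pi * t) = Real.sin (Real.pi * y)) :
    |tailKernel c N (3 * N) t| ≤ 5 * c N * (y + 1 / N)⁻¹ := by
  have hN' : (0 : ℝ) < N := by exact_mod_cast hN
  have h1 := abs_tailKernel_mul_sin_le hc hc0 (show N ≤ 3 * N by omega) t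
  have h2 := abs_tailKernel_le hc hc0 N (3 * N) t
  have h3 : 2 * y ≤ Real.sin (Real.pi * y) := by
    have h := Real.mul_le_sin (x := Real.pi * y) (by positivity)
      (by nlinarith [Real.pi_pos])
    rwa [← mul_assoc, div_mul_cancel₀ _ Real.pi_ne_zero] at h
  rw [abs_mul, hty, abs_of_nonneg (by linarith : 0 ≤ Real.sin (Real.pi * y))] at h1
  rw [show 3 * N - N = 2 * N by omega] at h2
  push_cast at h2
  rw [← div_eq_mul_inv, le_div_iff₀ (by positivity), mul_add, mul_one_div]
  have h4 : |tailKernel c N (3 * N) t| / N ≤ 4 * c N := by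
    rw [div_le_iff₀ hN']
    linarith
  nlinarith [abs_nonneg (tailKernel c N (3 * N) t)]

theorem integral_abs_tailKernel_le {c : ℕ → ℝ} (hc : Antitone c) (hc0 : ∀ k, 0 ≤ c k)
    {N : ℕ} (hN : 1 ≤ N) :
    ∫ t in (0 : ℝ)..1, |tailKernel c N (3 * N) t| ≤ 10 * c N * Real.log (N + 1) := by
  have hN' : (0 : ℝ) < N := by exact_mod_cast hN
  have hN1 : (0 : ℝ) < 1 / N := by positivity
  have hint : ∫ t in (0 : ℝ)..1, (t + 1 / (N : ℝ))⁻¹ = Real.log (N + 1) := by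
    rw [intervalIntegral.integral_comp_add_right (fun t => t⁻¹),
      integral_inv_of_pos (by linarith) (by linarith)]
    congr 1
    field_simp
    ring
  have hint' : ∫ t in (0 : ℝ)..1, (1 - t + 1 / (N : ℝ))⁻¹ = Real.log (N + 1) := by
    rw [intervalIntegral.integral_comp_sub_left (fun t => (t + 1 / (N : ℝ))⁻¹), ← hint]
    norm_num
  have hi : IntervalIntegrable (fun t : ℝ => (t + 1 / (N : ℝ))⁻¹) volume 0 1 := by
    refine ContinuousOn.intervalIntegrable_of_Icc zero_le_one ?_
    refine ContinuousOn.inv₀ (by fun_prop) fun t ht => ?_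
    linarith [ht.1]
  have hi' : IntervalIntegrable (fun t : ℝ => (1 - t + 1 / (N : ℝ))⁻¹) volume 0 1 := by
    refine ContinuousOn.intervalIntegrable_of_Icc zero_le_one ?_
    refine ContinuousOn.inv₀ (by fun_prop) fun t ht => ?_
    linarith [ht.2]
  calc ∫ t in (0 : ℝ)..1, |tailKernel c N (3 * N) t|
      ≤ ∫ t in (0 : ℝ)..1, 5 * c N * ((t + 1 / (N : ℝ))⁻¹ + (1 - t + 1 / (N : ℝ))⁻¹) := by
        refine intervalIntegral.integral_mono_on zero_le_one
          (Continuous.intervalIntegrable (by fun_prop) _ _) ((hi.add hi').const_mul _) ?_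
        rintro t ⟨ht0, ht1⟩
        have hA : 0 ≤ 5 * c N * (t + 1 / (N : ℝ))⁻¹ :=
          mul_nonneg (by linarith [hc0 N]) (inv_nonneg.2 (by linarith))
        have hB : 0 ≤ 5 * c N * (1 - t + 1 / (N : ℝ))⁻¹ :=
          mul_nonneg (by linarith [hc0 N]) (inv_nonneg.2 (by linarith))
        rw [mul_add]
        rcases le_total t (1 / 2) with h | h
        · linarith [abs_tailKernel_mul_le_of_le_half hc hc0 hN ht0 h rfl]
        · have := abs_tailKernel_mul_le_of_le_half hc hc0 hN (t := t) (y := 1 - t)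
            (by linarith) (by linarith)
            (by rw [mul_sub, mul_one, Real.sin_pi_sub])
          linarith
    _ = 10 * c N * Real.log (N + 1) := by
        rw [intervalIntegral.integral_const_mul, intervalIntegral.integral_add hi hi', hint, hint']
        ring

theorem norm_integral_mul_tailKernel_le {c : ℕ → ℝ} (hc : Antitone c) (hc0 : ∀ k, 0 ≤ c k)
    {N : ℕ} (hN : 1 ≤ N) {h : ℝ → ℂ} (hh : Continuous h) {B : ℝ} (hB : ∀ y, ‖h y‖ ≤ B) (x : ℝ) :
    ‖∫ y in (0 : ℝ)..1, h y * (tailKernel c N (3 * N) (x - y) : ℂ)‖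
      ≤ B * (10 * c N * Real.log (N + 1)) := by
  have hB0 : 0 ≤ B := (norm_nonneg _).trans (hB 0)
  have hshift : ∫ y in (0 : ℝ)..1, |tailKernel c N (3 * N) (x - y)|
      = ∫ t in (0 : ℝ)..1, |tailKernel c N (3 * N) t| := by
    rw [intervalIntegral.integral_comp_sub_left (fun t => |tailKernel c N (3 * N) t|), sub_zero]
    have hp : Function.Periodic (fun t => |tailKernel c N (3 * N) t|) 1 :=
      (tailKernel_periodic c N (3 * N)).comp abs
    have := hp.intervalIntegral_add_eq (x - 1) 0
    rwa [sub_add_cancel, zero_add] at this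
  calc ‖∫ y in (0 : ℝ)..1, h y * (tailKernel c N (3 * N) (x - y) : ℂ)‖
      ≤ ∫ y in (0 : ℝ)..1, ‖h y * (tailKernel c N (3 * N) (x - y) : ℂ)‖ :=
        intervalIntegral.norm_integral_le_integral_norm zero_le_one
    _ ≤ ∫ y in (0 : ℝ)..1, B * |tailKernel c N (3 * N) (x - y)| := by
        refine intervalIntegral.integral_mono_on zero_le_one
          (Continuous.intervalIntegrable (by fun_prop) _ _)
          (Continuous.intervalIntegrable (by fun_prop) _ _) fun y _ => ?_
        rw [norm_mul, Complex.norm_real, Real.norm_eq_abs]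
        exact mul_le_mul_of_nonneg_right (hB y) (abs_nonneg _)
    _ ≤ B * (10 * c N * Real.log (N + 1)) := by
        rw [intervalIntegral.integral_const_mul, hshift]
        exact mul_le_mul_of_nonneg_left (integral_abs_tailKernel_le hc hc0 hN) hB0

theorem sum_Icc_neg_eq_add {A : Type*} [AddCommMonoid A] (f : ℤ → A) {N M : ℕ} (h : N ≤ M) :
    ∑ k ∈ Finset.Icc (-(M : ℤ)) M, f k
      = ∑ k ∈ Finset.Icc (-(N : ℤ)) N, f k + ∑ k ∈ Finset.Ioc N M, (f k + f (-k)) := by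
  induction M, h using Nat.le_induction with
  | base => simp
  | succ M h ih =>
    have hI : Finset.Icc (-((M + 1 : ℕ) : ℤ)) ((M + 1 : ℕ) : ℤ)
        = insert ((M + 1 : ℕ) : ℤ) (insert (-((M + 1 : ℕ) : ℤ)) (Finset.Icc (-(M : ℤ)) M)) := by
      ext k
      simp only [Finset.mem_insert, Finset.mem_Icc]
      push_cast
      omega
    rw [hI, Finset.sum_insert, Finset.sum_insert, ih,
      ← Finset.insert_Ioc_right_eq_Ioc_add_one (by omega), Finset.sum_insert (by simp)]
    · rw [← add_assoc, add_left_comm]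
    · simp
    · simp only [Finset.mem_insert, Finset.mem_Icc]
      push_cast
      omega

/-- The Fourier multiplier of the resolvent restricted to the modes `N < |k| ≤ M` acts as
convolution with `tailKernel`. -/
theorem sum_Ioc_coef_eq_integral {h : ℝ → ℂ} (hh : Continuous h) (c : ℕ → ℝ) (N M : ℕ) (x : ℝ) :
    ∑ k ∈ Finset.Ioc N M, ((c k : ℂ) * coef h k * e1 ((k : ℤ) * x)
        + (c k : ℂ) * coef h (-k) * e1 ((-k : ℤ) * x))
      = ∫ y in (0 : ℝ)..1, h y * (tailKernel c N M (x - y) : ℂ) := by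
  simp only [tailKernel, Complex.ofReal_sum, Finset.mul_sum]
  rw [intervalIntegral.integral_finsetSum
    fun _ _ => Continuous.intervalIntegrable (by fun_prop) _ _]
  refine Finset.sum_congr rfl fun k _ => ?_
  have hmode : ∀ l : ℤ, (c k : ℂ) * coef h l * e1 (l * x)
      = ∫ y in (0 : ℝ)..1, h y * (c k * e1 (l * (x - y))) := by
    intro l
    rw [coef, ← intervalIntegral.integral_const_mul, ← intervalIntegral.integral_mul_const]
    congr 1
    ext y
    rw [show (l : ℝ) * (x - y) = -(l : ℝ) * y + l * x by ring, e1_add]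
    ring
  rw [hmode, hmode, ← intervalIntegral.integral_add
    (Continuous.intervalIntegrable (by fun_prop) _ _)
    (Continuous.intervalIntegrable (by fun_prop) _ _)]
  congr 1
  ext y
  rw [← mul_add, ← mul_add, Complex.ofReal_mul, ← e1_add_e1_neg]
  push_cast
  simp only [neg_mul]

theorem imexStep_eq (ν τ : ℝ) (N : ℕ) (u : ℝ → ℝ) (x : ℝ) :
    imexStep ν τ N u x = ∑ k ∈ Finset.Icc (-(N : ℤ)) N,
      (((1 + 4 * Real.pi ^ 2 * ν ^ 2 * τ * (k : ℝ) ^ 2)⁻¹ : ℝ) : ℂ) *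
        coef (fun y => (((1 + τ) * u y - τ * (u y) ^ 3 : ℝ) : ℂ)) k * e1 (k * x) := by
  simp only [imexStep, coef, integral_Ico_eq_integral_Ioc,
    intervalIntegral.integral_of_le zero_le_one]

theorem imexStep_mem_trigPoly (ν τ : ℝ) (N : ℕ) (u : ℝ → ℝ) :
    imexStep ν τ N u ∈ trigPoly N :=
  sum_mem_trigPoly N fun _ => _ * _

theorem abs_cubic_le {τ α v : ℝ} (hτ : 0 < τ) (hτ' : τ ≤ 1 / 2) (hα : 0 ≤ α) (hα' : α ≤ 1)
    (hv : |v| ≤ 1 + α) : |(1 + τ) * v - τ * v ^ 3| ≤ 1 + (1 - 2 * τ) * α := by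
  wlog h0 : 0 ≤ v generalizing v
  · have := this (v := -v) (by rwa [abs_neg]) (by linarith)
    rwa [show (1 + τ) * -v - τ * (-v) ^ 3 = -((1 + τ) * v - τ * v ^ 3) by ring, abs_neg] at this
  rw [abs_of_nonneg h0] at hv
  rw [abs_le]
  constructor
  · have h1 : v ^ 2 ≤ (1 + α) ^ 2 := by nlinarith
    have h2 : v * (τ * ((1 + α) ^ 2 - 1) - 1) ≤ 1 + (1 - 2 * τ) * α := by
      rcases le_total (τ * ((1 + α) ^ 2 - 1) - 1) 0 with h | h
      · nlinarith [mul_nonneg (by linarith : 0 ≤ 1 - 2 * τ) hα, mul_nonneg h0 (neg_nonneg.2 h)]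
      · have : τ * α ^ 2 * (3 + α) ≤ 1 / 2 * 1 * 4 := by
          gcongr
          · nlinarith
          · linarith
        nlinarith
    nlinarith [mul_nonneg h0 (mul_nonneg hτ.le (sub_nonneg.2 h1))]
  · rcases le_total v 1 with h | h
    · have h1 : τ * (v * (1 + v)) ≤ 1 / 2 * (1 * (1 + 1)) := by gcongr
      nlinarith [mul_nonneg (sub_nonneg.2 h) (sub_nonneg.2 h1),
        mul_nonneg (by linarith : 0 ≤ 1 - 2 * τ) hα]
    · have h1 : 0 ≤ (1 - 2 * τ) * (α - (v - 1)) := mul_nonneg (by linarith) (by linarith)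
      have h2 : 0 ≤ τ * ((v - 1) ^ 2 * (v + 2)) := by positivity
      nlinarith

theorem norm_imexStep_le {ν τ α : ℝ} (hν : 0 < ν) (hτ : 0 < τ) (hτ' : τ ≤ 1 / 2) {N : ℕ}
    (hN : 1 ≤ N) {u : ℝ → ℝ} (hu : (fun x => (u x : ℂ)) ∈ trigPoly N) (hα : 0 ≤ α) (hα' : α ≤ 1)
    (hB : ∀ x, |u x| ≤ 1 + α) (x : ℝ) :
    ‖imexStep ν τ N u x‖
      ≤ 1 + (1 - 2 * τ) * α + 60 / (ν ^ 2 * (N : ℝ) ^ 2) * Real.log ((N : ℝ) + 2) := by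
  set a : ℝ := 4 * Real.pi ^ 2 * ν ^ 2 * τ with ha
  have ha0 : 0 < a := by positivity
  have hN' : (0 : ℝ) < N := by exact_mod_cast hN
  set U : ℝ → ℂ := fun x => (u x : ℂ) with hU
  have hUc := continuous_of_mem_trigPoly hu
  have hU3 : U * U * U ∈ trigPoly (3 * N) := by
    have := mul_mem_trigPoly (mul_mem_trigPoly hu hu) hu
    rwa [show N + N + N = 3 * N by ring] at this
  set h : ℝ → ℂ := (τ : ℂ) • (U - U * U * U) with hh
  have hhm : h ∈ trigPoly (3 * N) :=
    Submodule.smul_mem _ _ (Submodule.sub_mem _ (trigPoly_mono (by omega) hu) hU3)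
  have hhc := continuous_of_mem_trigPoly hhm
  have hg : (fun y => (((1 + τ) * u y - τ * (u y) ^ 3 : ℝ) : ℂ)) = U + h := by
    ext y
    simp only [hU, hh, Pi.add_apply, Pi.smul_apply, Pi.sub_apply, Pi.mul_apply, smul_eq_mul]
    push_cast
    ring
  have hgm : U + h ∈ trigPoly (3 * N) := Submodule.add_mem _ (trigPoly_mono (by omega) hu) hhm
  have hgB : ∀ y, ‖(U + h) y‖ ≤ 1 + (1 - 2 * τ) * α := by
    intro y
    rw [← hg, Complex.norm_real]
    exact abs_cubic_le hτ hτ' hα hα' (hB y)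
  have hhB : ∀ y, ‖h y‖ ≤ 6 * τ := by
    intro y
    have h2 : |u y| ≤ 2 := (hB y).trans (by linarith)
    have : h y = ((τ * (u y - u y ^ 3) : ℝ) : ℂ) := by
      simp only [hU, hh, Pi.smul_apply, Pi.sub_apply, Pi.mul_apply, smul_eq_mul]
      push_cast
      ring
    rw [this, Complex.norm_real, Real.norm_eq_abs, abs_mul, abs_of_pos hτ, mul_comm]
    refine mul_le_mul_of_nonneg_right ?_ hτ.le
    rw [abs_le] at h2 ⊢
    constructor <;> nlinarith [sq_nonneg (u y), sq_nonneg (u y + 1), sq_nonneg (u y - 1)]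
  set c : ℕ → ℝ := fun k => (1 + a * (k : ℝ) ^ 2)⁻¹ with hcdef
  have hc : Antitone c := fun k l hkl => by
    simp only [hcdef]
    gcongr
  have hc0 : ∀ k, 0 ≤ c k := fun k => by positivity
  have hfull := norm_resolvent_le hgm ha0.le hgB x
  rw [sum_Icc_neg_eq_add _ (show N ≤ 3 * N by omega)] at hfull
  have htail := norm_integral_mul_tailKernel_le hc hc0 hN hhc hhB x
  rw [← sum_Ioc_coef_eq_integral hhc] at htail
  have hcoef : ∀ k : ℤ, k ∉ Set.Icc (-(N : ℤ)) N → coef (U + h) k = coef h k := fun k hk => by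
    rw [coef_add hUc hhc, coef_eq_zero_of_mem_trigPoly hu hk, zero_add]
  have hsum : ∑ k ∈ Finset.Ioc N (3 * N),
      ((((1 + a * ((k : ℤ) : ℝ) ^ 2)⁻¹ : ℝ) : ℂ) * coef (U + h) k * e1 ((k : ℤ) * x)
        + (((1 + a * ((-k : ℤ) : ℝ) ^ 2)⁻¹ : ℝ) : ℂ) * coef (U + h) (-k) * e1 ((-k : ℤ) * x))
      = ∑ k ∈ Finset.Ioc N (3 * N), ((c k : ℂ) * coef h k * e1 ((k : ℤ) * x)
        + (c k : ℂ) * coef h (-k) * e1 ((-k : ℤ) * x)) := by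
    refine Finset.sum_congr rfl fun k hk => ?_
    have hk' := (Finset.mem_Ioc.1 hk).1
    rw [hcoef k (by rw [Set.mem_Icc]; omega), hcoef (-k) (by rw [Set.mem_Icc]; omega)]
    simp [hcdef]
  rw [hsum] at hfull
  rw [imexStep_eq, hg]
  have hlog : Real.log (N + 1) ≤ Real.log (N + 2) := Real.log_le_log (by positivity) (by linarith)
  have hlog0 : 0 ≤ Real.log ((N : ℝ) + 1) := Real.log_nonneg (by linarith)
  have hcN : τ * c N ≤ 1 / (ν ^ 2 * (N : ℝ) ^ 2) := by
    rw [hcdef, ← div_eq_mul_inv, div_le_div_iff₀ (by positivity) (by positivity), ha]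
    have hp : 1 ≤ 4 * Real.pi ^ 2 := by nlinarith [Real.pi_gt_three]
    have : 0 ≤ (4 * Real.pi ^ 2 - 1) * (τ * (ν ^ 2 * (N : ℝ) ^ 2)) :=
      mul_nonneg (by linarith) (by positivity)
    nlinarith
  have hfin : 6 * τ * (10 * c N * Real.log (N + 1))
      ≤ 60 / (ν ^ 2 * (N : ℝ) ^ 2) * Real.log ((N : ℝ) + 2) := by
    calc 6 * τ * (10 * c N * Real.log (N + 1)) = 60 * (τ * c N) * Real.log (N + 1) := by ring
      _ ≤ 60 * (1 / (ν ^ 2 * (N : ℝ) ^ 2)) * Real.log ((N : ℝ) + 2) := by gcongr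
      _ = _ := by ring
  refine (norm_le_add_norm_add _ _).trans ((add_le_add hfull htail).trans ?_)
  linarith

/-- Fix `ν > 0` and `0 < τ_* ≤ 1/2`. There are an absolute constant
`β > 0` and `N₀` depending only on `(τ_*, ν)` such that for all `τ_* ≤ τ ≤ 1/2`, `N ≥ N₀`,
`0 ≤ α₀ ≤ 1`, and every sequence of iterates `uⁿ` of the implicit-explicit Fourier Galerkin
scheme starting from a real trigonometric polynomial `u⁰` of degree at most `N` with
`‖u⁰‖_∞ ≤ 1 + α₀`, one has for all `n ≥ 1`, with `θ = 1 − 2τ`: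
`‖uⁿ‖_∞ ≤ 1 + θⁿα₀ + (β/(ν²N²)) log(N+2) · (1 − θⁿ)/(1 − θ)`. -/
theorem statement19 :
    ∃ β : ℝ, 0 < β ∧
      ∀ ν : ℝ, 0 < ν → ∀ τstar : ℝ, 0 < τstar → τstar ≤ 1 / 2 →
        ∃ N₀ : ℕ, ∀ τ : ℝ, τstar ≤ τ → τ ≤ 1 / 2 →
          ∀ N : ℕ, N₀ ≤ N →
            ∀ α₀ : ℝ, 0 ≤ α₀ → α₀ ≤ 1 →
              ∀ u : ℕ → ℝ → ℝ,
                (∃ a : ℤ → ℂ, ∀ x : ℝ,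
                  ((u 0 x : ℝ) : ℂ)
                    = ∑ k ∈ Finset.Icc (-(N : ℤ)) (N : ℤ), a k * e1 ((k : ℝ) * x)) →
                (∀ x : ℝ, |u 0 x| ≤ 1 + α₀) →
                (∀ (n : ℕ) (x : ℝ), ((u (n + 1) x : ℝ) : ℂ) = imexStep ν τ N (u n) x) →
                ∀ n : ℕ, 1 ≤ n → ∀ x : ℝ,
                  |u n x| ≤ 1 + (1 - 2 * τ) ^ n * α₀ +
                    β / (ν ^ 2 * (N : ℝ) ^ 2) * Real.log ((N : ℝ) + 2) *
                      ((1 - (1 - 2 * τ) ^ n) / (1 - (1 - 2 * τ))) := by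
  refine ⟨60, by norm_num, fun ν hν τstar hτs _ => ?_⟩
  refine ⟨⌈60 / (ν ^ 2 * τstar)⌉₊ + 1, fun τ hτ hτ' N hN α₀ hα hα' u hu0 hB hrec n _ x => ?_⟩
  have hτ0 : 0 < τ := hτs.trans_le hτ
  have hN1 : 1 ≤ N := by omega
  have hN' : (1 : ℝ) ≤ N := by exact_mod_cast hN1
  set ε : ℝ := 60 / (ν ^ 2 * (N : ℝ) ^ 2) * Real.log ((N : ℝ) + 2) with hε
  have hlog0 : 0 ≤ Real.log ((N : ℝ) + 2) := Real.log_nonneg (by linarith)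
  have hε0 : 0 ≤ ε := by positivity
  have hε1 : ε ≤ 2 * τ := by
    have h1 : 60 / (ν ^ 2 * τstar) ≤ N :=
      (Nat.le_ceil _).trans (by exact_mod_cast (Nat.le_succ _).trans hN)
    rw [div_le_iff₀ (by positivity)] at h1
    have h2 : Real.log ((N : ℝ) + 2) ≤ 2 * N := by
      linarith [Real.log_le_sub_one_of_pos (show (0 : ℝ) < N + 2 by linarith)]
    rw [hε, div_mul_eq_mul_div, div_le_iff₀ (by positivity)]
    calc 60 * Real.log ((N : ℝ) + 2) ≤ (N * (ν ^ 2 * τstar)) * (2 * N) := by gcongr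
      _ ≤ (N * (ν ^ 2 * τ)) * (2 * N) := by gcongr
      _ = _ := by ring
  have htrig : ∀ n, (fun x => (u n x : ℂ)) ∈ trigPoly N := by
    intro n
    cases n with
    | zero =>
      obtain ⟨a, ha⟩ := hu0
      simpa only [ha] using sum_mem_trigPoly N a
    | succ n => simpa only [hrec] using imexStep_mem_trigPoly ν τ N (u n)
  set A : ℕ → ℝ := fun n => (1 - 2 * τ) ^ n * α₀ +
    ε * ((1 - (1 - 2 * τ) ^ n) / (1 - (1 - 2 * τ))) with hA
  have hAsucc : ∀ n, A (n + 1) = (1 - 2 * τ) * A n + ε := by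
    intro n
    simp only [hA, pow_succ, sub_sub_cancel]
    field_simp
    ring
  have key : ∀ n, 0 ≤ A n ∧ A n ≤ 1 ∧ ∀ x, |u n x| ≤ 1 + A n := by
    intro n
    induction n with
    | zero => simpa [hA] using ⟨hα, hα', hB⟩
    | succ n ih =>
      obtain ⟨h0, h1, h2⟩ := ih
      rw [hAsucc]
      refine ⟨by nlinarith, by nlinarith, fun x => ?_⟩
      have h := norm_imexStep_le hν hτ0 hτ' hN1 (htrig n) h0 h1 h2 x
      rw [← hrec, Complex.norm_real, Real.norm_eq_abs] at h
      linarith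
  have := (key n).2.2 x
  simp only [hA] at this
  linarith

end
end
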